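/- arXiv:1011.2897 — 3 statements merged into one kernel-verified Lean document; each statement's English description precedes it below -/
import Mathlib

section
/- For any positive integers a, b and any complex s avoiding singular points (e.g., for real s >= 2), T(a, b, s) + (-1)^b * T(b, s, a) + (-1)^a * T(s, a, b) = 2*N(a, b, s) + 2*N(b, a, s), where N(a, b, s) = sum_{j=0}^{floor(a/2)} binom(a+b-2j-1, b-1) * zeta(2j) * zeta(a+b+s-2j), with the convention zeta(0) = -1/2. -/
open Finset

noncomputable def tornheimT (s₁ s₂ s₃ : ℝ) : ℝ :=
  ∑' (m : ℕ) (n : ℕ),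
    1 / (((m : ℝ) + 1) ^ s₁ * ((n : ℝ) + 1) ^ s₂ * ((m : ℝ) + (n : ℝ) + 2) ^ s₃)

noncomputable def N (a b : ℕ) (s : ℂ) : ℂ :=
  ∑ j ∈ Finset.range (a / 2 + 1),
    ((a + b - 2 * j - 1).choose (b - 1) : ℂ) * riemannZeta (2 * j) *
      riemannZeta ((a : ℂ) + b + s - 2 * j)

open Filter Topology

/-- Truncation of the sum of `1 / (x ^ a * y ^ b)` over all nonzero integers `x`, `y`
with `x + y = i + 1`. -/
noncomputable def lineSum (i a b M : ℕ) : ℝ :=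
  ∑ m ∈ range i, (((m : ℝ) + 1) ^ a * ((i : ℝ) - m) ^ b)⁻¹ +
    ∑ m ∈ range M, ((((m : ℝ) + 1 + (i + 1)) ^ a * (-((m : ℝ) + 1)) ^ b)⁻¹ +
      ((-((m : ℝ) + 1)) ^ a * ((m : ℝ) + 1 + (i + 1)) ^ b)⁻¹)

/-- The real number `2 ζ(k)` for even `k`, and `0` for odd `k`. -/
noncomputable def evenZeta (k : ℕ) : ℝ :=
  if k = 0 then -1 else if Even k then 2 * ∑' m : ℕ, (((m : ℝ) + 1) ^ k)⁻¹ else 0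

/-- One of the two symmetric halves of the value of the sum of `1 / (x ^ a * y ^ b)` over
`x + y = n`. -/
noncomputable def lineValue (n : ℝ) (a b : ℕ) : ℝ :=
  ∑ d ∈ range (a + 1), (b.multichoose d : ℝ) * evenZeta (a - d) * (n ^ (b + d))⁻¹

lemma inv_pow_mul_pow_recurrence {x y n : ℝ} (hx : x ≠ 0) (hy : y ≠ 0) (hn : n ≠ 0)
    (h : x + y = n) (a b : ℕ) :
    (x ^ (a + 1) * y ^ (b + 1))⁻¹ =
      ((x ^ a * y ^ (b + 1))⁻¹ + (x ^ (a + 1) * y ^ b)⁻¹) / n := by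
  subst h
  field_simp
  ring

lemma lineSum_succ_succ (i a b M : ℕ) :
    lineSum i (a + 1) (b + 1) M =
      (lineSum i a (b + 1) M + lineSum i (a + 1) b M) / ((i : ℝ) + 1) := by
  have hn : (i : ℝ) + 1 ≠ 0 := by positivity
  have h₁ : ∑ m ∈ range i, (((m : ℝ) + 1) ^ (a + 1) * ((i : ℝ) - m) ^ (b + 1))⁻¹ =
      ∑ m ∈ range i, ((((m : ℝ) + 1) ^ a * ((i : ℝ) - m) ^ (b + 1))⁻¹ +
        (((m : ℝ) + 1) ^ (a + 1) * ((i : ℝ) - m) ^ b)⁻¹) / ((i : ℝ) + 1) := by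
    refine sum_congr rfl fun m hm => ?_
    have hm : (m : ℝ) < i := by exact_mod_cast mem_range.1 hm
    exact inv_pow_mul_pow_recurrence (by positivity) (by linarith) hn (by ring) a b
  unfold lineSum
  rw [h₁, ← sum_div, sum_add_distrib]
  have h₂ : ∀ m ∈ range M,
      (((m : ℝ) + 1 + (i + 1)) ^ (a + 1) * (-((m : ℝ) + 1)) ^ (b + 1))⁻¹ +
        ((-((m : ℝ) + 1)) ^ (a + 1) * ((m : ℝ) + 1 + (i + 1)) ^ (b + 1))⁻¹ =
      (((((m : ℝ) + 1 + (i + 1)) ^ a * (-((m : ℝ) + 1)) ^ (b + 1))⁻¹ +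
          ((-((m : ℝ) + 1)) ^ a * ((m : ℝ) + 1 + (i + 1)) ^ (b + 1))⁻¹) +
        ((((m : ℝ) + 1 + (i + 1)) ^ (a + 1) * (-((m : ℝ) + 1)) ^ b)⁻¹ +
          ((-((m : ℝ) + 1)) ^ (a + 1) * ((m : ℝ) + 1 + (i + 1)) ^ b)⁻¹)) / ((i : ℝ) + 1) := by
    intro m _
    have hx : (m : ℝ) + 1 + (i + 1) ≠ 0 := by positivity
    have hy : -((m : ℝ) + 1) ≠ 0 := neg_ne_zero.2 (by positivity)
    rw [inv_pow_mul_pow_recurrence hx hy hn (by ring) a b,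
      inv_pow_mul_pow_recurrence hy hx hn (by ring) a b]
    ring
  rw [sum_congr rfl h₂, ← sum_div, sum_add_distrib]
  ring

lemma lineSum_comm (i a b M : ℕ) : lineSum i a b M = lineSum i b a M := by
  unfold lineSum
  congr 1
  · rw [← sum_range_reflect]
    refine sum_congr rfl fun m hm => ?_
    have hm := mem_range.1 hm
    have h : ((i - 1 - m : ℕ) : ℝ) = (i : ℝ) - 1 - m := by
      rw [Nat.cast_sub (by omega), Nat.cast_sub (by omega)]
      simp
    rw [h, mul_comm]
    congr 3 <;> ring
  · refine sum_congr rfl fun m _ => ?_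
    rw [add_comm, mul_comm, mul_comm (_ ^ a) (_ ^ b)]

lemma lineValue_succ_succ {n : ℝ} (hn : n ≠ 0) (a b : ℕ) :
    lineValue n (a + 1) (b + 1) =
      (lineValue n a (b + 1) + lineValue n (a + 1) b) / n := by
  unfold lineValue
  rw [sum_range_succ', sum_range_succ' _ (a + 1), ← add_assoc, ← sum_add_distrib, add_div, sum_div]
  congr 1
  · refine sum_congr rfl fun d _ => ?_
    rw [Nat.multichoose_succ_succ, Nat.add_sub_add_right]
    push_cast
    field_simp
    ring
  · simp only [Nat.multichoose_zero_right]
    field_simp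
    simp [pow_succ]
    field_simp

lemma lineValue_zero_left (n : ℝ) (b : ℕ) : lineValue n 0 b = -(n ^ b)⁻¹ := by
  simp [lineValue, evenZeta]

lemma lineValue_zero_right (n : ℝ) (a : ℕ) : lineValue n a 0 = evenZeta a := by
  unfold lineValue
  rw [sum_range_succ']
  simp

lemma tendsto_lineSum_zero_right (i : ℕ) {a : ℕ} (ha : a ≠ 0) :
    Tendsto (lineSum i a 0) atTop (𝓝 (evenZeta a - (((i : ℝ) + 1) ^ a)⁻¹)) := by
  set H : ℕ → ℝ := fun M => ∑ m ∈ range M, (((m : ℝ) + 1) ^ a)⁻¹ with hH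
  have hS : ∀ M, lineSum i a 0 M =
      H (M + (i + 1)) + (-1) ^ a * H M - (((i : ℝ) + 1) ^ a)⁻¹ := by
    intro M
    have h : H (M + (i + 1)) = H i + (((i : ℝ) + 1) ^ a)⁻¹ +
        ∑ m ∈ range M, (((m : ℝ) + 1 + (i + 1)) ^ a)⁻¹ := by
      simp only [hH]
      rw [add_comm M, sum_range_add, sum_range_succ]
      congr 1
      refine sum_congr rfl fun m _ => ?_
      push_cast
      congr 2
      ring
    rw [h]
    simp only [lineSum, pow_zero, mul_one, sum_add_distrib, hH, mul_sum]
    have h' : ∀ m ∈ range M, ((-((m : ℝ) + 1)) ^ a)⁻¹ = (-1) ^ a * (((m : ℝ) + 1) ^ a)⁻¹ := by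
      intro m _
      rw [neg_pow, mul_inv, ← inv_pow, inv_neg_one]
    rw [sum_congr rfl h']
    ring
  rw [funext hS]
  refine Tendsto.sub_const ?_ _
  rcases Nat.even_or_odd a with he | ho
  · have hsum : Summable fun m : ℕ => (((m : ℝ) + 1) ^ a)⁻¹ := by
      have ha1 : 1 < a := by
        rcases he with ⟨c, hc⟩
        omega
      have := (summable_nat_add_iff 1).2 (Real.summable_nat_pow_inv.2 ha1)
      simpa using this
    have hlim := hsum.hasSum.tendsto_sum_nat
    rw [show evenZeta a = (∑' m : ℕ, (((m : ℝ) + 1) ^ a)⁻¹) +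
      (-1) ^ a * ∑' m : ℕ, (((m : ℝ) + 1) ^ a)⁻¹ by
        simp [evenZeta, ha, he, he.neg_one_pow, two_mul]]
    exact (hlim.comp (tendsto_add_atTop_nat (i + 1))).add (hlim.const_mul _)
  · have h : ∀ M, H (M + (i + 1)) + (-1) ^ a * H M =
        ∑ k ∈ range (i + 1), ((((M + k : ℕ) : ℝ) + 1) ^ a)⁻¹ := by
      intro M
      simp only [hH]
      rw [sum_range_add, ho.neg_one_pow]
      ring
    have h0 : evenZeta a = ∑ k ∈ range (i + 1), (0 : ℝ) := by
      simp [evenZeta, ha, Nat.not_even_iff_odd.2 ho]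
    rw [funext h, h0]
    refine tendsto_finsetSum _ fun k _ => ?_
    refine tendsto_inv_atTop_zero.comp ((tendsto_pow_atTop ha).comp ?_)
    refine tendsto_atTop_add_const_right _ _ (tendsto_natCast_atTop_atTop.comp ?_)
    exact tendsto_add_atTop_nat k

lemma tendsto_lineSum (i a b : ℕ) (h : a + b ≠ 0) :
    Tendsto (lineSum i a b) atTop
      (𝓝 (lineValue ((i : ℝ) + 1) a b + lineValue ((i : ℝ) + 1) b a)) := by
  have hn : (i : ℝ) + 1 ≠ 0 := by positivity
  induction a generalizing b with
  | zero =>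
    rw [funext (lineSum_comm i 0 b), lineValue_zero_left, lineValue_zero_right, neg_add_eq_sub]
    exact tendsto_lineSum_zero_right i (by omega)
  | succ a iha =>
    induction b with
    | zero =>
      rw [lineValue_zero_left, lineValue_zero_right, ← sub_eq_add_neg]
      exact tendsto_lineSum_zero_right i (by omega)
    | succ b ihb =>
      rw [funext (lineSum_succ_succ i a b), lineValue_succ_succ hn, lineValue_succ_succ hn]
      convert ((iha (b + 1) (by omega)).add (ihb (by omega))).div_const ((i : ℝ) + 1) using 2
      ring

lemma summable_inv_add_one_rpow {t : ℝ} (ht : 1 < t) :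
    Summable fun i : ℕ => (((i : ℝ) + 1) ^ t)⁻¹ := by
  have := (summable_nat_add_iff 1).2 (Real.summable_nat_rpow_inv.2 ht)
  simpa using this

lemma rpow_three_halves_mul_le {x y p q r : ℝ} (hx : 1 ≤ x) (hy : 1 ≤ y) (hp : 1 ≤ p)
    (hq : 1 ≤ q) (hr : 1 ≤ r) :
    x ^ (3 / 2 : ℝ) * y ^ (3 / 2 : ℝ) ≤ x ^ p * y ^ q * (x + y) ^ r := by
  have hx0 : 0 < x := by linarith
  have hy0 : 0 < y := by linarith
  have h : x ^ (1 / 2 : ℝ) * y ^ (1 / 2 : ℝ) ≤ (x + y) ^ r := calc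
    _ ≤ (x + y) ^ (1 / 2 : ℝ) * (x + y) ^ (1 / 2 : ℝ) := by gcongr <;> linarith
    _ = (x + y) ^ (1 : ℝ) := by rw [← Real.rpow_add (by linarith)]; norm_num
    _ ≤ (x + y) ^ r := Real.rpow_le_rpow_of_exponent_le (by linarith) hr
  calc
    _ = x ^ (1 : ℝ) * y ^ (1 : ℝ) * (x ^ (1 / 2 : ℝ) * y ^ (1 / 2 : ℝ)) := by
      rw [show (3 / 2 : ℝ) = 1 + 1 / 2 by norm_num, Real.rpow_add hx0, Real.rpow_add hy0]
      ring
    _ ≤ _ := by gcongr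

lemma summable_tornheim {p q r : ℝ} (hp : 1 ≤ p) (hq : 1 ≤ q) (hr : 1 ≤ r) :
    Summable fun x : ℕ × ℕ =>
      1 / (((x.1 : ℝ) + 1) ^ p * ((x.2 : ℝ) + 1) ^ q * ((x.1 : ℝ) + x.2 + 2) ^ r) := by
  have h : Summable fun i : ℕ => (((i : ℝ) + 1) ^ (3 / 2 : ℝ))⁻¹ :=
    summable_inv_add_one_rpow (by norm_num)
  refine Summable.of_nonneg_of_le (fun x => by positivity) (fun x => ?_)
    (h.mul_of_nonneg h (fun _ => by positivity) (fun _ => by positivity))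
  rw [← mul_inv, ← one_div]
  refine one_div_le_one_div_of_le (by positivity) ?_
  rw [show (x.1 : ℝ) + x.2 + 2 = (x.1 + 1) + (x.2 + 1) by ring]
  exact rpow_three_halves_mul_le (by simp) (by simp) hp hq hr

lemma tornheimT_comm {p q r : ℝ} (hp : 1 ≤ p) (hq : 1 ≤ q) (hr : 1 ≤ r) :
    tornheimT p q r = tornheimT q p r := by
  unfold tornheimT
  rw [← Summable.tsum_comm (f := fun m n : ℕ =>
    1 / (((m : ℝ) + 1) ^ p * ((n : ℝ) + 1) ^ q * ((m : ℝ) + (n : ℝ) + 2) ^ r))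
    (summable_tornheim hp hq hr)]
  refine tsum_congr fun m => tsum_congr fun n => ?_
  rw [mul_comm (_ ^ p), add_comm (n : ℝ) m]

lemma tornheim_term_eq (p q i m : ℕ) (s : ℝ) :
    1 / (((i : ℝ) + 1) ^ s * ((m : ℝ) + 1) ^ (p : ℝ) * ((i : ℝ) + m + 2) ^ (q : ℝ)) =
      (((i : ℝ) + 1) ^ s)⁻¹ * (((m : ℝ) + 1) ^ p * ((m : ℝ) + 1 + (i + 1)) ^ q)⁻¹ := by
  rw [Real.rpow_natCast, Real.rpow_natCast, one_div, mul_assoc, mul_inv]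
  congr 4
  ring

lemma summable_tornheim_inner {p q : ℕ} (hp : 1 ≤ p) (hq : 1 ≤ q) (i : ℕ) :
    Summable fun m : ℕ => (((m : ℝ) + 1) ^ p * ((m : ℝ) + 1 + (i + 1)) ^ q)⁻¹ := by
  have h := (summable_tornheim (p := 1) le_rfl (Nat.one_le_cast.2 hp)
    (Nat.one_le_cast.2 hq)).prod_factor i
  simp only [tornheim_term_eq] at h
  exact (summable_mul_left_iff (by positivity)).1 h

lemma hasSum_tornheimT_left {p q : ℕ} (hp : 1 ≤ p) (hq : 1 ≤ q) {s : ℝ} (hs : 1 ≤ s) :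
    HasSum (fun i : ℕ => (((i : ℝ) + 1) ^ s)⁻¹ *
      ∑' m : ℕ, (((m : ℝ) + 1) ^ p * ((m : ℝ) + 1 + (i + 1)) ^ q)⁻¹) (tornheimT s p q) := by
  have h := (summable_tornheim hs (Nat.one_le_cast.2 hp) (Nat.one_le_cast.2 hq)).prod.hasSum
  simpa only [tornheim_term_eq, tsum_mul_left, tornheimT] using h

lemma hasSum_tornheimT_antidiagonal {a b : ℕ} (ha : 1 ≤ a) (hb : 1 ≤ b) {s : ℝ} (hs : 1 ≤ s) :
    HasSum (fun i : ℕ => (((i : ℝ) + 1) ^ s)⁻¹ *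
      ∑ m ∈ range i, (((m : ℝ) + 1) ^ a * ((i : ℝ) - m) ^ b)⁻¹) (tornheimT a b s) := by
  have hsum := summable_tornheim (Nat.one_le_cast.2 ha) (Nat.one_le_cast.2 hb) hs
  have h := hsum.hasSum
  rw [hsum.tsum_prod] at h
  have h' := (HasAntidiagonal.sigmaAntidiagonalEquivProd.hasSum_iff.2 h).sigma fun k => hasSum_fintype _
  rw [show tornheimT a b s = tornheimT a b s + 0 by simp]
  have hz : (0 : ℝ) = ∑ i ∈ range 1, (((i : ℝ) + 1) ^ s)⁻¹ *
      ∑ m ∈ range i, (((m : ℝ) + 1) ^ a * ((i : ℝ) - m) ^ b)⁻¹ := by simp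
  rw [hz, ← hasSum_nat_add_iff 1]
  refine Eq.mpr (congrArg (HasSum · _) (funext fun k => ?_)) h'
  simp only [Function.comp_apply, HasAntidiagonal.sigmaAntidiagonalEquivProd_apply]
  rw [univ_eq_attach, sum_attach (antidiagonal k) (fun x : ℕ × ℕ => 1 / (((x.1 : ℝ) + 1) ^ (a : ℝ) *
    ((x.2 : ℝ) + 1) ^ (b : ℝ) * ((x.1 : ℝ) + x.2 + 2) ^ s)),
    Nat.sum_antidiagonal_eq_sum_range_succ_mk, mul_sum]
  refine sum_congr rfl fun m hm => ?_
  have hm : m ≤ k := Nat.lt_succ_iff.1 (mem_range.1 hm)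
  simp only [Real.rpow_natCast]
  rw [Nat.cast_sub hm, one_div, ← mul_inv]
  push_cast
  rw [show (m : ℝ) + (k - m) + 2 = k + 1 + 1 by ring, show (k : ℝ) - m + 1 = k + 1 - m by ring,
    mul_comm]

lemma tendsto_lineSum_tsum (i : ℕ) {a b : ℕ} (ha : 1 ≤ a) (hb : 1 ≤ b) :
    Tendsto (lineSum i a b) atTop
      (𝓝 (∑ m ∈ range i, (((m : ℝ) + 1) ^ a * ((i : ℝ) - m) ^ b)⁻¹ +
        ((-1) ^ b * ∑' m : ℕ, (((m : ℝ) + 1) ^ b * ((m : ℝ) + 1 + (i + 1)) ^ a)⁻¹ +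
          (-1) ^ a * ∑' m : ℕ, (((m : ℝ) + 1) ^ a * ((m : ℝ) + 1 + (i + 1)) ^ b)⁻¹))) := by
  have h := (((summable_tornheim_inner hb ha i).hasSum.mul_left ((-1) ^ b)).add
    ((summable_tornheim_inner ha hb i).hasSum.mul_left ((-1) ^ a))).tendsto_sum_nat
  refine (h.const_add _).congr fun M => ?_
  unfold lineSum
  congr 1
  refine sum_congr rfl fun m _ => ?_
  rw [neg_pow ((m : ℝ) + 1) a, neg_pow ((m : ℝ) + 1) b]
  simp only [mul_inv, ← inv_pow, inv_neg_one]
  ring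

lemma hasSum_lineValue {a b : ℕ} (ha : 1 ≤ a) (hb : 1 ≤ b) {s : ℝ} (hs : 1 ≤ s) :
    HasSum (fun i : ℕ => (((i : ℝ) + 1) ^ s)⁻¹ * lineValue ((i : ℝ) + 1) a b +
        (((i : ℝ) + 1) ^ s)⁻¹ * lineValue ((i : ℝ) + 1) b a)
      (tornheimT a b s + ((-1) ^ b * tornheimT b s a + (-1) ^ a * tornheimT s a b)) := by
  rw [tornheimT_comm (Nat.one_le_cast.2 hb) hs (Nat.one_le_cast.2 ha)]
  convert (hasSum_tornheimT_antidiagonal ha hb hs).add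
    (((hasSum_tornheimT_left hb ha hs).mul_left ((-1) ^ b)).add
      ((hasSum_tornheimT_left ha hb hs).mul_left ((-1) ^ a))) using 1
  ext i
  rw [← mul_add, tendsto_nhds_unique (tendsto_lineSum i a b (by omega))
    (tendsto_lineSum_tsum i ha hb)]
  ring

lemma sum_range_eq_sum_range_even {a : ℕ} {f : ℕ → ℂ} (h : ∀ k, ¬ Even k → f k = 0) :
    ∑ k ∈ range (a + 1), f k = ∑ j ∈ range (a / 2 + 1), f (2 * j) := by
  symm
  rw [← sum_image (f := f) (g := fun j => 2 * j) (fun x _ y _ hxy => by simpa using hxy)]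
  refine sum_subset ?_ ?_
  · intro k hk
    simp only [mem_image, mem_range] at hk ⊢
    omega
  · intro k hk hk'
    refine h k fun ⟨c, hc⟩ => hk' ?_
    simp only [mem_image, mem_range] at hk ⊢
    exact ⟨c, by omega, by omega⟩

lemma ofReal_evenZeta {k : ℕ} (hk : Even k) : (evenZeta k : ℂ) = 2 * riemannZeta k := by
  by_cases h0 : k = 0
  · simp only [h0, evenZeta, if_true, Nat.cast_zero, riemannZeta_zero]
    norm_num
  · have hk1 : 1 < k := by
      rcases hk with ⟨c, hc⟩
      omega
    rw [zeta_eq_tsum_one_div_nat_add_one_cpow (by simpa using hk1)]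
    simp [evenZeta, h0, hk, Complex.ofReal_tsum]

lemma ofReal_tsum_inv_rpow {t : ℝ} (ht : 1 < t) :
    ((∑' i : ℕ, (((i : ℝ) + 1) ^ t)⁻¹ : ℝ) : ℂ) = riemannZeta t := by
  rw [zeta_eq_tsum_one_div_nat_add_one_cpow (by simpa using ht), Complex.ofReal_tsum]
  refine tsum_congr fun i => ?_
  rw [Complex.ofReal_inv, Complex.ofReal_cpow (by positivity)]
  simp

lemma inv_rpow_mul_lineValue (a b i : ℕ) (s : ℝ) :
    (((i : ℝ) + 1) ^ s)⁻¹ * lineValue ((i : ℝ) + 1) a b =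
      ∑ d ∈ range (a + 1), (b.multichoose d : ℝ) * evenZeta (a - d) *
        (((i : ℝ) + 1) ^ (s + (b + d : ℕ)))⁻¹ := by
  rw [lineValue, mul_sum]
  refine sum_congr rfl fun d _ => ?_
  rw [Real.rpow_add (by positivity), Real.rpow_natCast, mul_inv]
  ring

lemma summable_inv_rpow_mul_lineValue (a b : ℕ) {s : ℝ} (hs : 1 < s) :
    Summable fun i : ℕ => (((i : ℝ) + 1) ^ s)⁻¹ * lineValue ((i : ℝ) + 1) a b := by
  simp only [inv_rpow_mul_lineValue]
  refine summable_sum fun d _ => (summable_inv_add_one_rpow ?_).mul_left _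
  have : (0 : ℝ) ≤ (b + d : ℕ) := Nat.cast_nonneg _
  linarith

lemma tsum_lineValue (a : ℕ) {b : ℕ} (hb : 1 ≤ b) {s : ℝ} (hs : 1 < s) :
    ((∑' i : ℕ, (((i : ℝ) + 1) ^ s)⁻¹ * lineValue ((i : ℝ) + 1) a b : ℝ) : ℂ) =
      2 * N a b s := by
  have ht : ∀ d : ℕ, 1 < s + (b + d : ℕ) := fun d => by
    have : (0 : ℝ) ≤ (b + d : ℕ) := Nat.cast_nonneg _
    linarith
  simp only [inv_rpow_mul_lineValue]
  rw [Summable.tsum_finsetSum fun d _ => (summable_inv_add_one_rpow (ht d)).mul_left _]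
  simp only [tsum_mul_left]
  push_cast
  simp only [← Complex.ofReal_inv, ← Complex.ofReal_natCast]
  set F : ℕ → ℂ := fun k => (b.multichoose (a - k) : ℂ) * (evenZeta k : ℂ) *
    riemannZeta ((s + (b + (a - k) : ℕ) : ℝ) : ℂ) with hF
  have hodd : ∀ k, ¬ Even k → F k = 0 := by
    intro k hk
    have : k ≠ 0 := by
      rintro rfl
      simp at hk
    simp [hF, evenZeta, hk, this]
  calc
    _ = ∑ d ∈ range (a + 1), F (a + 1 - 1 - d) := by
      refine sum_congr rfl fun d hd => ?_
      have hd := mem_range.1 hd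
      simp only [hF, Nat.add_sub_cancel, Nat.sub_sub_self (Nat.lt_succ_iff.1 hd)]
      rw [← ofReal_tsum_inv_rpow (ht d)]
      push_cast
      rfl
    _ = ∑ j ∈ range (a / 2 + 1), F (2 * j) := by
      rw [sum_range_reflect, sum_range_eq_sum_range_even hodd]
    _ = 2 * N a b s := by
      rw [N, mul_sum]
      refine sum_congr rfl fun j hj => ?_
      have hj : 2 * j ≤ a := by
        have := mem_range.1 hj
        omega
      have hc : b.multichoose (a - 2 * j) = (a + b - 2 * j - 1).choose (b - 1) := by
        rw [Nat.multichoose_eq, show b + (a - 2 * j) - 1 = (b - 1) + (a - 2 * j) by omega,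
          show a + b - 2 * j - 1 = (b - 1) + (a - 2 * j) by omega, Nat.choose_symm_add]
      simp only [hF]
      rw [hc, ofReal_evenZeta (even_two_mul j)]
      push_cast [Nat.cast_sub hj]
      rw [show (s : ℂ) + (b + (a - 2 * j)) = a + b + s - 2 * j by ring]
      ring

theorem funcEq_T (a b : ℕ) (ha : 1 ≤ a) (hb : 1 ≤ b) (s : ℝ) (hs : 2 ≤ s) :
    (tornheimT a b s : ℂ) + (-1) ^ b * (tornheimT b s a : ℝ) +
      (-1) ^ a * (tornheimT s a b : ℝ) =
    2 * N a b s + 2 * N b a s := by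
  have h := (hasSum_lineValue ha hb (by linarith : 1 ≤ s)).tsum_eq
  rw [Summable.tsum_add (summable_inv_rpow_mul_lineValue a b (by linarith))
    (summable_inv_rpow_mul_lineValue b a (by linarith))] at h
  rw [← tsum_lineValue a hb (by linarith), ← tsum_lineValue b ha (by linarith),
    ← Complex.ofReal_add, h]
  push_cast
  ring
end

section
/- For any positive integer p, S(2p, 2p, 2p) + 2*R(2p, 2p, 2p) = 4 * sum_{j=0}^{p} binom(4p-2j-1, 2p-1) * (2^{2j+1-6p} - 1) * zeta(2j) * zeta(6p-2j), with zeta(0) = -1/2. -/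
open Finset

noncomputable def tornheimS (s₁ s₂ s₃ : ℝ) : ℝ :=
  ∑' (m : ℕ) (n : ℕ),
    (-1 : ℝ) ^ ((m + 1) + (n + 1)) /
      (((m : ℝ) + 1) ^ s₁ * ((n : ℝ) + 1) ^ s₂ * ((m : ℝ) + (n : ℝ) + 2) ^ s₃)

noncomputable def tornheimR (s₁ s₂ s₃ : ℝ) : ℝ :=
  ∑' (m : ℕ) (n : ℕ),
    (-1 : ℝ) ^ (n + 1) /
      (((m : ℝ) + 1) ^ s₁ * ((n : ℝ) + 1) ^ s₂ * ((m : ℝ) + (n : ℝ) + 2) ^ s₃)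

theorem HasSum.of_eq {ι : Type*} {f g : ι → ℝ} {a b : ℝ} (h : HasSum f a) (hfg : ∀ x, g x = f x)
    (hab : b = a) : HasSum g b := by
  rw [funext hfg, hab]
  exact h

theorem sum_choose_mul_pow_sub (R S : ℕ) (b : ℝ) :
    ∑ k ∈ range (S + 1), ((R + k).choose k : ℝ) * b ^ k
      - (1 - b) * ∑ k ∈ range (S + 1), ((R + 1 + k).choose k : ℝ) * b ^ k
      = ((R + 1 + S).choose S : ℝ) * b ^ (S + 1) := by
  induction S with
  | zero => simp
  | succ S ih =>
    rw [sum_range_succ _ (S + 1), sum_range_succ _ (S + 1)]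
    have h : ((R + 1 + (S + 1)).choose (S + 1) : ℝ)
        = (R + 1 + S).choose S + (R + (S + 1)).choose (S + 1) := by
      rw [show R + 1 + (S + 1) = (R + 1 + S) + 1 by ring, Nat.choose_succ_succ,
        show R + 1 + S = R + (S + 1) by ring]
      push_cast; ring
    linear_combination ih - b ^ (S + 1) * h

theorem sum_choose_mul_pow_add_eq_one (R S : ℕ) {a b : ℝ} (hab : a + b = 1) :
    b ^ (S + 1) * ∑ k ∈ range (R + 1), ((S + k).choose k : ℝ) * a ^ k
      + a ^ (R + 1) * ∑ k ∈ range (S + 1), ((R + k).choose k : ℝ) * b ^ k = 1 := by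
  obtain rfl : a = 1 - b := by linarith
  induction R with
  | zero =>
    have := mul_neg_geom_sum b (S + 1)
    simp only [zero_add, Nat.choose_self, Nat.cast_one, one_mul, pow_one, range_one,
      sum_singleton, add_zero, Nat.choose_zero_right, pow_zero, mul_one]
    linear_combination this
  | succ R ih =>
    rw [sum_range_succ _ (R + 1)]
    have h := sum_choose_mul_pow_sub R S b
    have hc : ((S + (R + 1)).choose (R + 1) : ℝ) = (R + 1 + S).choose S := by
      rw [show R + 1 + S = S + (R + 1) by ring, Nat.choose_symm_add]
    rw [hc]
    linear_combination ih - (1 - b) ^ (R + 1) * h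

/-- Partial fraction decomposition of `1 / (m n) ^ (r + 1)` in terms of `m + n`. -/
theorem inv_pow_mul_inv_pow_eq_sum (r : ℕ) {m n : ℝ} (hm : m ≠ 0) (hn : n ≠ 0) (hmn : m + n ≠ 0) :
    m⁻¹ ^ (r + 1) * n⁻¹ ^ (r + 1) = ∑ k ∈ range (r + 1),
      ((r + k).choose k : ℝ) * (m + n)⁻¹ ^ (r + 1 + k) *
        (m⁻¹ ^ (r + 1 - k) + n⁻¹ ^ (r + 1 - k)) := by
  have h := sum_choose_mul_pow_add_eq_one r r (a := m / (m + n)) (b := n / (m + n))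
    (by field_simp)
  rw [← mul_one (m⁻¹ ^ (r + 1) * n⁻¹ ^ (r + 1)), ← h, mul_add, mul_sum, mul_sum, mul_sum, mul_sum,
    ← sum_add_distrib]
  refine sum_congr rfl fun k hk => ?_
  have key (x : ℝ) (hx : x ≠ 0) : x⁻¹ ^ (r + 1) * (x / (m + n)) ^ k
      = (m + n)⁻¹ ^ k * x⁻¹ ^ (r + 1 - k) := by
    have hk' : r + 1 = (r + 1 - k) + k := by have := mem_range.1 hk; omega
    nth_rewrite 1 [hk']
    rw [pow_add, mul_assoc, ← mul_pow, mul_comm]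
    congr 2
    field_simp
  have key' (x : ℝ) (hx : x ≠ 0) : x⁻¹ ^ (r + 1) * (x / (m + n)) ^ (r + 1)
      = (m + n)⁻¹ ^ (r + 1) := by
    rw [← mul_pow]
    congr 1
    field_simp
  rw [pow_add (m + n)⁻¹ (r + 1) k]
  linear_combination (r + k).choose k * (n⁻¹ ^ (r + 1) * (n / (m + n)) ^ (r + 1)) * key m hm
    + (r + k).choose k * ((m + n)⁻¹ ^ k * m⁻¹ ^ (r + 1 - k)) * key' n hn
    + (r + k).choose k * (m⁻¹ ^ (r + 1) * (m / (m + n)) ^ (r + 1)) * key n hn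
    + (r + k).choose k * ((m + n)⁻¹ ^ k * n⁻¹ ^ (r + 1 - k)) * key' m hm

theorem hasSum_nat_inv_succ_sub_inv : HasSum (fun n : ℕ => ((n : ℝ) + 1)⁻¹ - (n : ℝ)⁻¹) 0 := by
  rw [← hasSum_nat_add_iff' 1]
  suffices h : HasSum (fun n : ℕ => ((n : ℝ) + 1)⁻¹ - ((n : ℝ) + 2)⁻¹) 1 by
    convert h.neg using 1
    · funext n; push_cast; ring
    · simp
  rw [hasSum_iff_tendsto_nat_of_nonneg]
  · have h (N : ℕ) : ∑ n ∈ range N, (((n : ℝ) + 1)⁻¹ - ((n : ℝ) + 2)⁻¹)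
        = 1 - ((N : ℝ) + 1)⁻¹ := by
      induction N with
      | zero => simp
      | succ N ih => rw [sum_range_succ, ih]; push_cast; ring
    simp only [h]
    simpa [one_div] using
      (tendsto_one_div_add_atTop_nhds_zero_nat (𝕜 := ℝ)).const_sub 1
  · intro n
    rw [sub_nonneg]
    gcongr
    norm_num

theorem hasSum_int_inv_succ_sub_inv : HasSum (fun n : ℤ => ((n : ℝ) + 1)⁻¹ - (n : ℝ)⁻¹) 0 := by
  rw [← add_zero (0 : ℝ)]
  refine HasSum.of_nat_of_neg_add_one ?_ ?_
  · simpa using hasSum_nat_inv_succ_sub_inv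
  · refine hasSum_nat_inv_succ_sub_inv.of_eq (fun n => ?_) rfl
    push_cast
    rw [show -((n : ℝ) + 1) + 1 = -n by ring, inv_neg, inv_neg]
    ring

theorem hasSum_int_inv_add_inv_sub (y : ℤ) :
    HasSum (fun m : ℤ => (m : ℝ)⁻¹ + ((y : ℝ) - m)⁻¹) 0 := by
  have step (z : ℤ) : HasSum (fun m : ℤ => ((z : ℝ) + 1 - m)⁻¹ - ((z : ℝ) - m)⁻¹) 0 := by
    convert (Equiv.subLeft z).hasSum_iff.2 hasSum_int_inv_succ_sub_inv using 1
    funext m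
    simp only [Function.comp, Equiv.subLeft_apply]
    push_cast
    ring_nf
  induction y using Int.induction_on with
  | zero => simp [hasSum_zero]
  | succ i ih =>
    convert ih.add (step i) using 1
    · funext m; push_cast; ring
    · simp
  | pred i ih =>
    refine (ih.sub (step (-i - 1))).of_eq (fun m => ?_) (sub_zero 0).symm
    push_cast
    rw [sub_add_cancel]
    ring

theorem summable_int_inv_pow {k : ℕ} (hk : 2 ≤ k) : Summable fun n : ℤ => (n : ℝ)⁻¹ ^ k := by
  simpa [one_div, inv_pow] using Real.summable_one_div_int_pow.2 (show 1 < k by omega)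

theorem tsum_int_inv_pow_of_odd {k : ℕ} (hk : Odd k) : ∑' n : ℤ, (n : ℝ)⁻¹ ^ k = 0 := by
  have h := (Equiv.neg ℤ).tsum_eq fun n : ℤ => (n : ℝ)⁻¹ ^ k
  simp only [Equiv.neg_apply, Int.cast_neg, inv_neg, hk.neg_pow, tsum_neg] at h
  linarith

theorem hasSum_int_inv_pow_add_inv_sub_pow {k : ℕ} (hk : 1 ≤ k) (y : ℤ) :
    HasSum (fun m : ℤ => (m : ℝ)⁻¹ ^ k + ((y : ℝ) - m)⁻¹ ^ k)
      (if Even k then 2 * ∑' n : ℤ, (n : ℝ)⁻¹ ^ k else 0) := by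
  obtain rfl | hk := hk.eq_or_lt
  · simpa using hasSum_int_inv_add_inv_sub y
  have h := (summable_int_inv_pow hk).hasSum
  have h' := h.add ((Equiv.subLeft y).hasSum_iff.2 h)
  simp only [Function.comp_def, Equiv.subLeft_apply, Int.cast_sub, ← two_mul] at h'
  split_ifs with hp
  · exact h'
  · rwa [tsum_int_inv_pow_of_odd (Nat.not_even_iff_odd.1 hp), mul_zero] at h'

/-- The convolution of `m ↦ m ^ (-(r + 1))` with itself over the nonzero integers. -/
theorem hasSum_int_convolution (r : ℕ) {y : ℤ} (hy : y ≠ 0) :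
    HasSum (fun m : ℤ => (m : ℝ)⁻¹ ^ (r + 1) * ((y : ℝ) - m)⁻¹ ^ (r + 1))
      (∑ k ∈ range (r + 1), ((r + k).choose k : ℝ) * (y : ℝ)⁻¹ ^ (r + 1 + k) *
          (if Even (r + 1 - k) then 2 * ∑' n : ℤ, (n : ℝ)⁻¹ ^ (r + 1 - k) else 0)
        - 2 * ((2 * r + 1).choose r : ℝ) * (y : ℝ)⁻¹ ^ (2 * (r + 1))) := by
  have h1 : HasSum (fun m : ℤ => ∑ k ∈ range (r + 1),
      ((r + k).choose k : ℝ) * (y : ℝ)⁻¹ ^ (r + 1 + k) *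
        ((m : ℝ)⁻¹ ^ (r + 1 - k) + ((y : ℝ) - m)⁻¹ ^ (r + 1 - k))) _ :=
    hasSum_sum fun k hk => (hasSum_int_inv_pow_add_inv_sub_pow
      (by have := mem_range.1 hk; omega) y).mul_left
        (((r + k).choose k : ℝ) * (y : ℝ)⁻¹ ^ (r + 1 + k))
  set c : ℝ := ((2 * r + 1).choose r : ℝ) * (y : ℝ)⁻¹ ^ (2 * (r + 1)) with hc
  have hsum : ∑ k ∈ range (r + 1), ((r + k).choose k : ℝ) * (y : ℝ)⁻¹ ^ (r + 1 + k) *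
      (y : ℝ)⁻¹ ^ (r + 1 - k) = c := by
    have hch := Nat.sum_range_add_choose r r
    rw [hc, show 2 * r + 1 = r + (r + 1) by ring, Nat.choose_symm_add,
      show r + (r + 1) = r + r + 1 by ring, ← hch, Nat.cast_sum, sum_mul]
    refine sum_congr rfl fun k hk => ?_
    rw [mul_assoc, ← pow_add, add_comm k r, Nat.choose_symm_add]
    congr 2
    have := mem_range.1 hk
    omega
  have h2 := (hasSum_ite_eq (0 : ℤ) c).add (hasSum_ite_eq y c)
  refine (h1.sub h2).of_eq (fun m => ?_) ?_
  · by_cases hm : m = 0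
    · subst hm
      rw [if_pos rfl, if_neg hy.symm, add_zero, ← hsum, ← sum_sub_distrib]
      symm
      simp only [Int.cast_zero, inv_zero, sub_zero]
      rw [zero_pow (by omega), zero_mul]
      refine sum_eq_zero fun k hk => ?_
      rw [zero_pow (by have := mem_range.1 hk; omega)]
      ring
    by_cases hmy : m = y
    · subst hmy
      rw [if_pos rfl, if_neg hm, zero_add, ← hsum, ← sum_sub_distrib]
      symm
      simp only [sub_self, inv_zero]
      rw [zero_pow (by omega), mul_zero]
      refine sum_eq_zero fun k hk => ?_
      rw [zero_pow (by have := mem_range.1 hk; omega)]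
      ring
    rw [if_neg hm, if_neg hmy, inv_pow_mul_inv_pow_eq_sum r (Int.cast_ne_zero.2 hm)
      (sub_ne_zero.2 (Int.cast_injective.ne (Ne.symm hmy))) (by simpa using hy)]
    simp
  · rw [hc]; ring

theorem tsum_int_neg_one_zpow_mul_inv_pow {k : ℕ} (hk : 2 ≤ k) :
    ∑' n : ℤ, (-1 : ℝ) ^ n * (n : ℝ)⁻¹ ^ k
      = (2 ^ (1 - (k : ℤ)) - 1) * ∑' n : ℤ, (n : ℝ)⁻¹ ^ k := by
  have hs := summable_int_inv_pow hk
  have hinj : Function.Injective fun n : ℤ => 2 * n := fun a b h => by simpa using h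
  have h : HasSum (fun n : ℤ => ((-1 : ℝ) ^ n + 1) * (n : ℝ)⁻¹ ^ k)
      (2 * (2⁻¹ ^ k * ∑' n : ℤ, (n : ℝ)⁻¹ ^ k)) := by
    rw [← hinj.hasSum_iff]
    · refine ((hs.hasSum.mul_left (2⁻¹ ^ k)).mul_left 2).of_eq (fun n => ?_) rfl
      simp only [Function.comp]
      rw [(even_two_mul n).neg_one_zpow]
      push_cast
      rw [mul_inv, mul_pow]
      ring
    · intro n hn
      have : Odd n := by
        rw [← Int.not_even_iff_odd]
        rintro ⟨m, rfl⟩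
        exact hn ⟨m, two_mul m⟩
      simp [this.neg_one_zpow]
  have h' := h.sub hs.hasSum
  rw [show (2 : ℝ) ^ (1 - (k : ℤ)) = 2 * 2⁻¹ ^ k by
    rw [zpow_sub₀ two_ne_zero, zpow_one, zpow_natCast, inv_pow, div_eq_mul_inv]]
  rw [show (fun n : ℤ => (-1 : ℝ) ^ n * (n : ℝ)⁻¹ ^ k)
    = fun n : ℤ => ((-1 : ℝ) ^ n + 1) * (n : ℝ)⁻¹ ^ k - (n : ℝ)⁻¹ ^ k by funext n; ring,
    h'.tsum_eq]
  ring

theorem two_mul_riemannZeta_nat_of_even {k : ℕ} (hk : 2 ≤ k) (hk' : Even k) :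
    2 * riemannZeta k = ((∑' n : ℤ, (n : ℝ)⁻¹ ^ k : ℝ) : ℂ) := by
  rw [two_mul_riemannZeta_eq_tsum_int_inv_pow_of_even hk hk', Complex.ofReal_tsum]
  simp

/-- The summand of the symmetric double series over the integers. -/
noncomputable def symmTerm (a : ℕ) (x : ℤ × ℤ) : ℝ :=
  (-1 : ℝ) ^ (x.1 + x.2) * ((x.1 : ℝ)⁻¹ ^ a * (x.2 : ℝ)⁻¹ ^ a * ((x.1 : ℝ) + x.2)⁻¹ ^ a)

theorem summable_symmTerm {a : ℕ} (ha : 2 ≤ a) : Summable (symmTerm a) := by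
  have h := (summable_int_inv_pow ha).norm
  refine Summable.of_norm_bounded (h.mul_of_nonneg h (fun _ => norm_nonneg _)
    fun _ => norm_nonneg _) fun x => ?_
  have h1 : ‖((x.1 : ℝ) + x.2)⁻¹ ^ a‖ ≤ 1 := by
    rw [norm_pow, norm_inv]
    refine pow_le_one₀ (by positivity) ?_
    rw [← Int.cast_add, Int.norm_cast_real]
    obtain h0 | h0 := eq_or_ne (x.1 + x.2) 0
    · simp [h0]
    · exact inv_le_one_of_one_le₀ (by
        rw [Int.norm_eq_abs]; exact_mod_cast Int.one_le_abs h0)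
  rw [symmTerm, norm_mul, norm_zpow, norm_neg, norm_one, one_zpow, one_mul, norm_mul, norm_mul]
  exact mul_le_of_le_one_right (by positivity) h1

theorem symmTerm_neg {a : ℕ} (ha : Even a) (x y : ℤ) :
    symmTerm a (-x, -y) = symmTerm a (x, y) := by
  simp only [symmTerm, Int.cast_neg]
  rw [← neg_add, ← neg_add, zpow_neg, inv_neg, inv_neg, inv_neg, ha.neg_pow, ha.neg_pow,
    ha.neg_pow, ← inv_zpow, inv_neg, inv_one]

theorem symmTerm_swap (a : ℕ) (x y : ℤ) : symmTerm a (x, y) = symmTerm a (y, x) := by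
  simp only [symmTerm]
  rw [add_comm x y, add_comm (x : ℝ) y, mul_comm ((x : ℝ)⁻¹ ^ a)]

/-- The six parametrizations of pairs of nonzero integers with nonzero sum. -/
def sextant : Fin 6 × ℕ × ℕ → ℤ × ℤ
  | (i, m, n) => ![((m : ℤ) + 1, (n : ℤ) + 1), (-(m + 1), -(n + 1)),
      (m + 1 + (n + 1), -(m + 1)), (-(m + 1 + (n + 1)), m + 1),
      (-(m + 1), m + 1 + (n + 1)), (m + 1, -(m + 1 + (n + 1)))] i

theorem sextant_injective : Function.Injective sextant := by
  rintro ⟨i, m, n⟩ ⟨j, m', n'⟩ h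
  fin_cases i <;> fin_cases j <;> simp [sextant] at h ⊢ <;> omega

theorem mem_range_sextant {x y : ℤ} (hx : x ≠ 0) (hy : y ≠ 0) (hxy : x + y ≠ 0) :
    (x, y) ∈ Set.range sextant := by
  rcases hx.lt_or_gt with hx | hx <;> rcases hy.lt_or_gt with hy | hy
  · exact ⟨(1, (-x - 1).toNat, (-y - 1).toNat), by simp [sextant]; omega⟩
  · rcases hxy.lt_or_gt with hxy | hxy
    · exact ⟨(3, (y - 1).toNat, (-x - y - 1).toNat), by simp [sextant]; omega⟩
    · exact ⟨(4, (-x - 1).toNat, (x + y - 1).toNat), by simp [sextant]; omega⟩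
  · rcases hxy.lt_or_gt with hxy | hxy
    · exact ⟨(5, (x - 1).toNat, (-x - y - 1).toNat), by simp [sextant]; omega⟩
    · exact ⟨(2, (-y - 1).toNat, (x + y - 1).toNat), by simp [sextant]; omega⟩
  · exact ⟨(0, (x - 1).toNat, (y - 1).toNat), by simp [sextant]; omega⟩

theorem support_symmTerm_subset {a : ℕ} (ha : a ≠ 0) :
    Function.support (symmTerm a) ⊆ Set.range sextant := by
  rintro ⟨x, y⟩ h
  refine mem_range_sextant ?_ ?_ ?_ <;> intro h0 <;> apply h
  · simp [symmTerm, h0, ha]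
  · simp [symmTerm, h0, ha]
  · have : (x : ℝ) + y = 0 := by exact_mod_cast h0
    simp [symmTerm, this, ha]

theorem tsum_symmTerm_eq_tornheim {p : ℕ} (hp : 1 ≤ p) :
    ∑' x, symmTerm (2 * p) x = 2 * tornheimS (2 * p) (2 * p) (2 * p)
      + 4 * tornheimR (2 * p) (2 * p) (2 * p) := by
  have hs := sextant_injective.summable_iff
    (fun x hx => by_contra fun h => hx (support_symmTerm_subset (by omega) h)) |>.2
    (summable_symmTerm (show 2 ≤ 2 * p by omega))
  have hsi (i : Fin 6) : Summable fun x : ℕ × ℕ => symmTerm (2 * p) (sextant (i, x)) :=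
    hs.prod_factor i
  rw [← sextant_injective.tsum_eq (support_symmTerm_subset (by omega)),
    show (fun x => symmTerm (2 * p) (sextant x)) = symmTerm (2 * p) ∘ sextant from rfl,
    hs.tsum_prod, tsum_fintype]
  have hrpow (x : ℝ) : x ^ (2 * (p : ℝ)) = x ^ (2 * p) := by
    rw [← Real.rpow_natCast]; push_cast; rfl
  have he : Even (2 * p) := even_two_mul p
  have hS (i : Fin 6) (hi : i = 0 ∨ i = 1) :
      ∑' x : ℕ × ℕ, (symmTerm (2 * p) ∘ sextant) (i, x)
        = tornheimS (2 * p) (2 * p) (2 * p) := by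
    rw [tornheimS]
    refine (hsi i).tsum_prod.trans ?_
    refine tsum_congr fun m => tsum_congr fun n => ?_
    have h : symmTerm (2 * p) (sextant (i, m, n))
        = symmTerm (2 * p) ((m : ℤ) + 1, (n : ℤ) + 1) := by
      obtain rfl | rfl := hi
      · rfl
      · exact symmTerm_neg he _ _
    rw [h]
    simp only [hrpow, symmTerm]
    rw [show (-1 : ℝ) ^ ((m : ℤ) + 1 + (n + 1)) = (-1) ^ (m + 1 + (n + 1)) by norm_cast]
    push_cast
    rw [show (m : ℝ) + 1 + (n + 1) = m + n + 2 by ring, div_eq_mul_inv, mul_inv, mul_inv,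
      inv_pow, inv_pow, inv_pow]
  have hR (i : Fin 6) (hi : i ≠ 0 ∧ i ≠ 1) :
      ∑' x : ℕ × ℕ, (symmTerm (2 * p) ∘ sextant) (i, x)
        = tornheimR (2 * p) (2 * p) (2 * p) := by
    rw [tornheimR]
    refine (hsi i).tsum_prod.trans ?_
    refine tsum_congr fun m => tsum_congr fun n => ?_
    have h3 := symmTerm_neg he ((m : ℤ) + 1 + (n + 1)) (-(m + 1))
    rw [neg_neg] at h3
    have h : symmTerm (2 * p) (sextant (i, m, n))
        = symmTerm (2 * p) ((m : ℤ) + 1 + (n + 1), -((m : ℤ) + 1)) := by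
      fin_cases i
      · exact absurd rfl hi.1
      · exact absurd rfl hi.2
      · rfl
      · exact h3
      · exact symmTerm_swap _ _ _
      · exact (symmTerm_swap _ _ _).trans h3
    rw [h]
    simp only [hrpow, symmTerm]
    rw [add_neg_cancel_comm,
      show (-1 : ℝ) ^ ((n : ℤ) + 1) = (-1) ^ (n + 1) by norm_cast]
    push_cast
    rw [add_neg_cancel_comm, show (m : ℝ) + 1 + (n + 1) = m + n + 2 by ring, div_eq_mul_inv,
      mul_inv, mul_inv, inv_neg, he.neg_pow, inv_pow, inv_pow, inv_pow]
    ring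
  rw [Fin.sum_univ_six, hS 0 (by decide), hS 1 (by decide), hR 2 (by decide), hR 3 (by decide),
    hR 4 (by decide), hR 5 (by decide)]
  ring

theorem tsum_symmTerm_eq_sum {r : ℕ} (hr : 1 ≤ r) :
    ∑' x, symmTerm (r + 1) x =
      ∑ k ∈ range (r + 1), ((r + k).choose k : ℝ) *
        (if Even (r + 1 - k) then 2 * ∑' n : ℤ, (n : ℝ)⁻¹ ^ (r + 1 - k) else 0) *
        (∑' y : ℤ, (-1 : ℝ) ^ y * (y : ℝ)⁻¹ ^ (2 * (r + 1) + k))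
      - 2 * ((2 * r + 1).choose r : ℝ) * ∑' y : ℤ, (-1 : ℝ) ^ y * (y : ℝ)⁻¹ ^ (3 * (r + 1)) := by
  let e : ℤ × ℤ ≃ ℤ × ℤ :=
    ⟨fun x => (x.2, x.1 - x.2), fun x => (x.1 + x.2, x.1), fun x => by simp, fun x => by simp⟩
  have hs : Summable fun x => symmTerm (r + 1) (e x) :=
    e.summable_iff.2 (summable_symmTerm (by omega))
  have halt {k : ℕ} (hk : 2 ≤ k) : HasSum (fun y : ℤ => (-1 : ℝ) ^ y * (y : ℝ)⁻¹ ^ k)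
      (∑' y : ℤ, (-1 : ℝ) ^ y * (y : ℝ)⁻¹ ^ k) :=
    (Summable.of_norm (by simpa using (summable_int_inv_pow hk).norm)).hasSum
  rw [← e.tsum_eq, hs.tsum_prod]
  refine HasSum.tsum_eq (HasSum.of_eq (HasSum.sub (hasSum_sum fun k (_ : k ∈ range (r + 1)) =>
    (halt (show 2 ≤ 2 * (r + 1) + k by omega)).mul_left (((r + k).choose k : ℝ) *
        (if Even (r + 1 - k) then 2 * ∑' n : ℤ, (n : ℝ)⁻¹ ^ (r + 1 - k) else 0)))
    ((halt (show 2 ≤ 3 * (r + 1) by omega)).mul_left (2 * ((2 * r + 1).choose r : ℝ))))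
    (fun y => ?_) rfl)
  have hterm (m : ℤ) : symmTerm (r + 1) (e (y, m)) = (-1) ^ y * (y : ℝ)⁻¹ ^ (r + 1) *
      ((m : ℝ)⁻¹ ^ (r + 1) * ((y : ℝ) - m)⁻¹ ^ (r + 1)) := by
    simp only [symmTerm, e, Equiv.coe_fn_mk, add_sub_cancel, Int.cast_sub]
    ring
  simp only [hterm, tsum_mul_left]
  obtain rfl | hy := eq_or_ne y 0
  · simp
  rw [(hasSum_int_convolution r hy).tsum_eq, mul_sub, mul_sum]
  congr 1
  · refine sum_congr rfl fun k _ => ?_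
    rw [show 2 * (r + 1) + k = r + 1 + (r + 1 + k) by ring, pow_add _ (r + 1)]
    ring
  · rw [show 3 * (r + 1) = r + 1 + 2 * (r + 1) by ring, pow_add _ (r + 1)]
    ring

theorem sum_range_two_mul_of_odd_eq_zero {f : ℕ → ℝ} {p : ℕ}
    (hf : ∀ k < 2 * p, Odd k → f k = 0) :
    ∑ k ∈ range (2 * p), f k = ∑ l ∈ range p, f (2 * l) := by
  induction p with
  | zero => simp
  | succ p ih =>
    rw [show 2 * (p + 1) = 2 * p + 1 + 1 by ring, sum_range_succ, sum_range_succ,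
      ih fun k hk => hf k (by omega), sum_range_succ,
      hf _ (by omega) (odd_two_mul_add_one p), add_zero]

theorem ofReal_tsum_int_neg_one_zpow_mul_inv_pow {k : ℕ} (hk : 2 ≤ k) (hk' : Even k) :
    ((∑' n : ℤ, (-1 : ℝ) ^ n * (n : ℝ)⁻¹ ^ k : ℝ) : ℂ)
      = (2 ^ (1 - (k : ℤ)) - 1) * (2 * riemannZeta k) := by
  rw [tsum_int_neg_one_zpow_mul_inv_pow hk, two_mul_riemannZeta_nat_of_even hk hk']
  push_cast
  rfl

theorem tsum_symmTerm_eq_sum_of_even {p : ℕ} (hp : 1 ≤ p) :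
    ∑' x, symmTerm (2 * p) x =
      ∑ j ∈ range p, ((4 * p - 2 * (j + 1) - 1).choose (2 * p - 1) : ℝ) *
        (2 * ∑' n : ℤ, (n : ℝ)⁻¹ ^ (2 * (j + 1))) *
        (∑' y : ℤ, (-1 : ℝ) ^ y * (y : ℝ)⁻¹ ^ (6 * p - 2 * (j + 1)))
      - 2 * ((4 * p - 1).choose (2 * p - 1) : ℝ) *
        ∑' y : ℤ, (-1 : ℝ) ^ y * (y : ℝ)⁻¹ ^ (6 * p) := by
  have h := tsum_symmTerm_eq_sum (r := 2 * p - 1) (by omega)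
  rw [show 2 * p - 1 + 1 = 2 * p by omega, sum_range_two_mul_of_odd_eq_zero] at h
  · rw [h, ← sum_range_reflect, show 2 * (2 * p - 1) + 1 = 4 * p - 1 by omega,
      show 3 * (2 * p) = 6 * p by ring]
    congr 1
    refine sum_congr rfl fun j hj => ?_
    have hj := mem_range.1 hj
    rw [show 2 * p - 2 * (p - 1 - j) = 2 * (j + 1) by omega, if_pos (even_two_mul _),
      Nat.choose_symm_add.symm,
      show 2 * p - 1 + 2 * (p - 1 - j) = 4 * p - 2 * (j + 1) - 1 by omega,
      show 2 * (2 * p) + 2 * (p - 1 - j) = 6 * p - 2 * (j + 1) by omega]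
  · intro k hkp hk
    rw [if_neg, mul_zero, zero_mul]
    rw [Nat.even_sub hkp.le]
    simp [Nat.not_even_iff_odd.2 hk]

theorem eval_S_plus_2R_even (p : ℕ) (hp : 1 ≤ p) :
    (tornheimS (2 * p) (2 * p) (2 * p) : ℂ) + 2 * (tornheimR (2 * p) (2 * p) (2 * p) : ℝ) =
      4 * ∑ j ∈ Finset.range (p + 1),
        ((4 * p - 2 * j - 1).choose (2 * p - 1) : ℂ) *
          ((2 : ℂ) ^ ((2 * j + 1 : ℤ) - 6 * p) - 1) * riemannZeta (2 * j) *
          riemannZeta ((6 * p - 2 * j : ℕ)) := by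
  have h := (tsum_symmTerm_eq_tornheim hp).symm.trans (tsum_symmTerm_eq_sum_of_even hp)
  have he : Even (6 * p) := ⟨3 * p, by ring⟩
  have hc := congrArg (fun x : ℝ => (x : ℂ)) h
  simp only [Complex.ofReal_add, Complex.ofReal_sub, Complex.ofReal_mul, Complex.ofReal_ofNat,
    Complex.ofReal_sum, Complex.ofReal_natCast] at hc
  rw [ofReal_tsum_int_neg_one_zpow_mul_inv_pow (by omega) he] at hc
  have hterm : ∀ j ∈ range p, ((4 * p - 2 * (j + 1) - 1).choose (2 * p - 1) : ℂ) *
        (2 * ((∑' n : ℤ, (n : ℝ)⁻¹ ^ (2 * (j + 1)) : ℝ) : ℂ)) *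
        ((∑' y : ℤ, (-1 : ℝ) ^ y * (y : ℝ)⁻¹ ^ (6 * p - 2 * (j + 1)) : ℝ) : ℂ)
      = 8 * (((4 * p - 2 * (j + 1) - 1).choose (2 * p - 1) : ℂ) *
          ((2 : ℂ) ^ ((2 * (j + 1 : ℕ) + 1 : ℤ) - 6 * p) - 1) * riemannZeta (2 * (j + 1 : ℕ)) *
          riemannZeta ((6 * p - 2 * (j + 1) : ℕ))) := by
    intro j hj
    have hj := mem_range.1 hj
    rw [← two_mul_riemannZeta_nat_of_even (by omega) (even_two_mul _),
      ofReal_tsum_int_neg_one_zpow_mul_inv_pow (by omega)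
        ((Nat.even_sub (by omega)).2 (by simp [he])),
      show (1 : ℤ) - (6 * p - 2 * (j + 1) : ℕ) = (2 * (j + 1 : ℕ) + 1 : ℤ) - 6 * p by omega,
      Nat.cast_mul 2 (j + 1), Nat.cast_ofNat]
    ring
  rw [sum_congr rfl hterm, ← mul_sum] at hc
  rw [sum_range_succ']
  simp only [mul_zero, Nat.cast_zero, zero_add, Nat.sub_zero, riemannZeta_zero]
  rw [show (1 : ℤ) - (6 * p : ℕ) = 1 - 6 * p by push_cast; rfl] at hc
  linear_combination hc / 2
end

section
/- For any nonnegative integer p (with the series interpreted as absolutely convergent iterated sums, valid for p >= 1, or via Abel summation for p = 0), S(2p+1, 2p+1, 2p+1) = 2^{-6p} * sum_{j=0}^{p} binom(4p+1-2j, 2p) * (2^{2j-1} - 1) * zeta(2j) * zeta(6p+3-2j), with zeta(0) = -1/2. -/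
open Finset

/-- The truncated negative binomial series satisfies a Pascal-type recursion. -/
lemma sum_choose_mul_pow_recursion (x : ℝ) (n a : ℕ) :
    (1 - x) * ∑ k ∈ range a, ((n + 1 + k).choose (n + 1) : ℝ) * x ^ k +
      ((n + a).choose (n + 1) : ℝ) * x ^ a = ∑ k ∈ range a, ((n + k).choose n : ℝ) * x ^ k := by
  induction a with
  | zero => simp
  | succ a ih =>
    rw [sum_range_succ, sum_range_succ, ← ih, show n + 1 + a = (n + a) + 1 by ring,
      show n + (a + 1) = (n + a) + 1 by ring, Nat.choose_succ_succ]
    push_cast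
    ring

/-- The Chaundy–Bullard identity. -/
lemma chaundy_bullard (x y : ℝ) (h : x + y = 1) (q : ℕ) :
    ∑ k ∈ range (q + 1), ((q + k).choose q : ℝ) * (x ^ k * y ^ (q + 1) + x ^ (q + 1) * y ^ k)
      = 1 := by
  induction q with
  | zero => simp; linarith
  | succ n ih =>
    have key : ((n + (n + 2)).choose (n + 1) : ℝ) = 2 * ((n + (n + 1)).choose n : ℝ) := by
      rw [show n + (n + 2) = (2 * n + 1) + 1 by ring, show n + (n + 1) = 2 * n + 1 by ring,
        Nat.choose_succ_succ, Nat.choose_symm_half]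
      push_cast
      ring
    have e : ∀ (m N : ℕ), ∑ k ∈ range N,
        ((m + k).choose m : ℝ) * (x ^ k * y ^ (m + 1) + x ^ (m + 1) * y ^ k) =
        y ^ (m + 1) * ∑ k ∈ range N, ((m + k).choose m : ℝ) * x ^ k +
        x ^ (m + 1) * ∑ k ∈ range N, ((m + k).choose m : ℝ) * y ^ k := by
      intro m N
      rw [mul_sum, mul_sum, ← sum_add_distrib]
      exact sum_congr rfl fun k _ => by ring
    rw [e] at ih ⊢
    have hx' := sum_choose_mul_pow_recursion x n (n + 2)
    have hy' := sum_choose_mul_pow_recursion y n (n + 2)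
    rw [sum_range_succ (fun k => ((n + k).choose n : ℝ) * x ^ k), key,
      show 1 - x = y by linarith] at hx'
    rw [sum_range_succ (fun k => ((n + k).choose n : ℝ) * y ^ k), key,
      show 1 - y = x by linarith] at hy'
    linear_combination ih + y ^ (n + 1) * hx' + x ^ (n + 1) * hy' +
      (-2) * ((n + (n + 1)).choose n : ℝ) * x ^ (n + 1) * y ^ (n + 1) * h

/-- Partial fraction decomposition of `1 / (x y) ^ (q + 1)` in terms of `x + y`. -/
lemma inv_mul_pow_partial_fractions {x y : ℝ} (hx : x ≠ 0) (hy : y ≠ 0) (h : x + y ≠ 0) (q : ℕ) :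
    ((x * y) ^ (q + 1))⁻¹ = ∑ k ∈ range (q + 1), ((q + k).choose q : ℝ) *
      ((x + y) ^ (q + 1 + k))⁻¹ * ((x ^ (q + 1 - k))⁻¹ + (y ^ (q + 1 - k))⁻¹) := by
  have := chaundy_bullard (x / (x + y)) (y / (x + y)) (by field_simp) q
  rw [← mul_one ((x * y) ^ (q + 1))⁻¹, ← this, mul_sum]
  refine sum_congr rfl fun k hk => ?_
  obtain ⟨d, hd⟩ := Nat.exists_eq_add_of_le (Nat.lt_succ_iff.mp (mem_range.mp hk))
  rw [show q + 1 - k = d + 1 by omega, show q + 1 + k = (d + 1) + k + k by omega,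
    show q + 1 = (d + 1) + k by omega]
  simp only [div_pow, mul_pow, pow_add _ (d + 1)]
  field_simp
  ring

lemma summable_inv_natCast_succ_pow {i : ℕ} (hi : 1 < i) :
    Summable fun k : ℕ => (((k : ℝ) + 1) ^ i)⁻¹ := by
  have := (summable_nat_add_iff 1).2 (Real.summable_nat_pow_inv.2 hi)
  simpa using this

lemma tsum_inv_natCast_succ_pow {i : ℕ} (hi : 1 < i) :
    ∑' k : ℕ, (((k : ℝ) + 1) ^ i)⁻¹ = ∑' k : ℕ, ((k : ℝ) ^ i)⁻¹ := by
  rw [(Real.summable_nat_pow_inv.2 hi).tsum_eq_zero_add]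
  simp [show i ≠ 0 by omega]

open Filter Topology

lemma tendsto_signed_power_sums {i : ℕ} (hi : i ≠ 0) (N : ℕ) :
    Tendsto (fun M : ℕ => (-1 : ℝ) ^ i * ∑ k ∈ range M, (((k : ℝ) + 1) ^ i)⁻¹ +
      ∑ k ∈ range (N + M), (((k : ℝ) + 1) ^ i)⁻¹) atTop
      (𝓝 (if Even i then 2 * ∑' k : ℕ, ((k : ℝ) ^ i)⁻¹ else 0)) := by
  split_ifs with h
  · have hi1 : 1 < i := by
      rcases h with ⟨k, rfl⟩
      omega
    have hs := (summable_inv_natCast_succ_pow hi1).hasSum.tendsto_sum_nat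
    rw [tsum_inv_natCast_succ_pow hi1] at hs
    have := hs.add (hs.comp (tendsto_add_atTop_nat N))
    simpa [h.neg_one_pow, two_mul, add_comm N] using this
  · have ho : (-1 : ℝ) ^ i = -1 := (Nat.not_even_iff_odd.1 h).neg_one_pow
    have : (fun M : ℕ => (-1 : ℝ) ^ i * ∑ k ∈ range M, (((k : ℝ) + 1) ^ i)⁻¹ +
        ∑ k ∈ range (N + M), (((k : ℝ) + 1) ^ i)⁻¹) =
        fun M : ℕ => ∑ j ∈ range N, ((((M + j : ℕ) : ℝ) + 1) ^ i)⁻¹ := by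
      ext M
      rw [ho, add_comm N M, sum_range_add]
      ring
    rw [this]
    have h0 : Tendsto (fun M : ℕ => (((M : ℝ) + 1) ^ i)⁻¹) atTop (𝓝 0) :=
      tendsto_inv_atTop_zero.comp ((tendsto_pow_atTop hi).comp
        (tendsto_atTop_add_const_right _ 1 tendsto_natCast_atTop_atTop))
    simpa using tendsto_finsetSum (range N) fun j _ => h0.comp (tendsto_add_atTop_nat j)

lemma summable_inv_mul_add_pow {r : ℕ} (hr : 1 < r) (N : ℕ) :
    Summable fun k : ℕ => (((k : ℝ) * (N + k)) ^ r)⁻¹ := by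
  refine Summable.of_nonneg_of_le (fun k => by positivity) (fun k => ?_)
    (Real.summable_nat_pow_inv.2 hr)
  rcases Nat.eq_zero_or_pos k with rfl | hk
  · simp
  · have : (1 : ℝ) ≤ k := by exact_mod_cast hk
    have hN : (0 : ℝ) ≤ N := by positivity
    refine inv_anti₀ (by positivity) (pow_le_pow_left₀ (by positivity) ?_ r)
    nlinarith

/-- The convolution minus twice the correlation of `k ↦ k⁻¹ ^ (q + 1)`, for even `q`. -/
lemma convolution_sub_two_mul_correlation {q : ℕ} (hq : Even q) (hq0 : q ≠ 0) (K : ℕ) :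
    ∑ m ∈ range K, ((((m : ℝ) + 1) * (K - m)) ^ (q + 1))⁻¹ -
      2 * ∑' k : ℕ, (((k : ℝ) * ((K + 1 : ℕ) + k)) ^ (q + 1))⁻¹ =
    2 * ∑ k ∈ range (q + 1), ((q + k).choose q : ℝ) * (((K : ℝ) + 1) ^ (q + 1 + k))⁻¹ *
      ((if Even (q + 1 - k) then 2 * ∑' k' : ℕ, ((k' : ℝ) ^ (q + 1 - k))⁻¹ else 0) -
        (((K : ℝ) + 1) ^ (q + 1 - k))⁻¹) := by
  have hc : ∑ m ∈ range K, ((((m : ℝ) + 1) * (K - m)) ^ (q + 1))⁻¹ =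
      2 * ∑ k ∈ range (q + 1), ((q + k).choose q : ℝ) * (((K : ℝ) + 1) ^ (q + 1 + k))⁻¹ *
        ∑ m ∈ range K, (((m : ℝ) + 1) ^ (q + 1 - k))⁻¹ := by
    have e : ∀ m ∈ range K, ((((m : ℝ) + 1) * (K - m)) ^ (q + 1))⁻¹ =
        ∑ k ∈ range (q + 1), ((q + k).choose q : ℝ) * (((K : ℝ) + 1) ^ (q + 1 + k))⁻¹ *
          ((((m : ℝ) + 1) ^ (q + 1 - k))⁻¹ + (((K : ℝ) - m) ^ (q + 1 - k))⁻¹) := by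
      intro m hm
      have hm' : (m : ℝ) < K := by exact_mod_cast mem_range.1 hm
      rw [inv_mul_pow_partial_fractions (by positivity) (by linarith)
        (by linarith [show (0 : ℝ) ≤ m by positivity]),
        show (m : ℝ) + 1 + (K - m) = K + 1 by ring]
    rw [sum_congr rfl e, sum_comm, mul_sum]
    refine sum_congr rfl fun k _ => ?_
    rw [← mul_sum, sum_add_distrib]
    have : ∑ m ∈ range K, (((K : ℝ) - m) ^ (q + 1 - k))⁻¹ =
        ∑ m ∈ range K, (((m : ℝ) + 1) ^ (q + 1 - k))⁻¹ := by
      rw [← sum_range_reflect]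
      refine sum_congr rfl fun m hm => ?_
      have := mem_range.1 hm
      rw [Nat.sub_sub, Nat.cast_sub (by omega)]
      push_cast
      congr 2
      ring
    rw [this]
    ring
  have hd : ∀ M : ℕ, ∑ k' ∈ range (M + 1), (((k' : ℝ) * ((K + 1 : ℕ) + k')) ^ (q + 1))⁻¹ =
      -∑ k ∈ range (q + 1), ((q + k).choose q : ℝ) * (((K : ℝ) + 1) ^ (q + 1 + k))⁻¹ *
        (((-1 : ℝ) ^ (q + 1 - k) * ∑ m ∈ range M, (((m : ℝ) + 1) ^ (q + 1 - k))⁻¹ +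
          ∑ m ∈ range (K + 1 + M), (((m : ℝ) + 1) ^ (q + 1 - k))⁻¹) -
          ∑ m ∈ range (K + 1), (((m : ℝ) + 1) ^ (q + 1 - k))⁻¹) := by
    intro M
    have e : ∀ m ∈ range M, ((((m + 1 : ℕ) : ℝ) * ((K + 1 : ℕ) + (m + 1 : ℕ))) ^ (q + 1))⁻¹ =
        -∑ k ∈ range (q + 1), ((q + k).choose q : ℝ) * (((K : ℝ) + 1) ^ (q + 1 + k))⁻¹ *
          ((-1 : ℝ) ^ (q + 1 - k) * (((m : ℝ) + 1) ^ (q + 1 - k))⁻¹ +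
            ((((K + 1 + m : ℕ) : ℝ) + 1) ^ (q + 1 - k))⁻¹) := by
      intro m _
      have hpf := inv_mul_pow_partial_fractions (x := -((m : ℝ) + 1)) (y := K + m + 2)
        (neg_ne_zero.2 (by positivity)) (by positivity)
        (by rw [show -((m : ℝ) + 1) + (K + m + 2) = K + 1 by ring]; positivity) q
      rw [show -((m : ℝ) + 1) + (K + m + 2) = K + 1 by ring, neg_mul,
        hq.add_one.neg_pow, inv_neg] at hpf
      have e1 : ∀ i : ℕ, ((-((m : ℝ) + 1)) ^ i)⁻¹ = (-1 : ℝ) ^ i * (((m : ℝ) + 1) ^ i)⁻¹ := by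
        intro i
        rw [neg_pow, mul_inv, ← inv_pow, inv_neg, inv_one]
      simp only [e1] at hpf
      rw [eq_neg_iff_add_eq_zero, add_comm, ← eq_neg_iff_add_eq_zero]
      push_cast
      rw [show (K : ℝ) + 1 + (m + 1) = K + m + 2 by ring]
      simp only [show (K : ℝ) + 1 + m + 1 = K + m + 2 by ring]
      exact hpf.symm
    rw [sum_range_succ', sum_congr rfl e, sum_neg_distrib, sum_comm]
    simp only [Nat.cast_zero, zero_mul, zero_pow (Nat.succ_ne_zero q), inv_zero, add_zero]
    congr 1
    refine sum_congr rfl fun k _ => ?_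
    rw [← mul_sum, sum_add_distrib, ← mul_sum, sum_range_add _ (K + 1) M]
    ring
  have hlim := (((summable_inv_mul_add_pow (r := q + 1) (by omega) (K + 1)).hasSum.tendsto_sum_nat).comp
    (tendsto_add_atTop_nat 1))
  have hlim2 : Tendsto (fun M : ℕ => -∑ k ∈ range (q + 1),
      ((q + k).choose q : ℝ) * (((K : ℝ) + 1) ^ (q + 1 + k))⁻¹ *
        (((-1 : ℝ) ^ (q + 1 - k) * ∑ m ∈ range M, (((m : ℝ) + 1) ^ (q + 1 - k))⁻¹ +
          ∑ m ∈ range (K + 1 + M), (((m : ℝ) + 1) ^ (q + 1 - k))⁻¹) -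
          ∑ m ∈ range (K + 1), (((m : ℝ) + 1) ^ (q + 1 - k))⁻¹)) atTop
      (𝓝 (-∑ k ∈ range (q + 1), ((q + k).choose q : ℝ) * (((K : ℝ) + 1) ^ (q + 1 + k))⁻¹ *
        ((if Even (q + 1 - k) then 2 * ∑' k' : ℕ, ((k' : ℝ) ^ (q + 1 - k))⁻¹ else 0) -
          ∑ m ∈ range (K + 1), (((m : ℝ) + 1) ^ (q + 1 - k))⁻¹))) := by
    refine (tendsto_finsetSum _ fun k hk => ?_).neg
    have := mem_range.1 hk
    exact ((tendsto_signed_power_sums (by omega) (K + 1)).sub_const _).const_mul _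
  have heq := tendsto_nhds_unique (hlim.congr hd) hlim2
  rw [heq, hc, mul_neg, sub_neg_eq_add, ← mul_add, ← sum_add_distrib]
  congr 1
  refine sum_congr rfl fun k _ => ?_
  rw [sum_range_succ _ K]
  ring

lemma sum_range_two_mul_add_one {M : Type*} [AddCommMonoid M] (f : ℕ → M) (p : ℕ) :
    ∑ k ∈ range (2 * p + 1), f k =
      ∑ l ∈ range (p + 1), f (2 * l) + ∑ l ∈ range p, f (2 * l + 1) := by
  induction p with
  | zero => simp
  | succ p ih =>
    rw [show 2 * (p + 1) + 1 = (2 * p + 1) + 1 + 1 by ring, sum_range_succ, sum_range_succ, ih,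
      sum_range_succ _ (p + 1), sum_range_succ _ p, sum_range_succ _ p]
    rw [show 2 * (p + 1) = 2 * p + 1 + 1 by ring]
    abel

/-- The zeta value at `2 j` as a real number. -/
noncomputable def zetaEven (j : ℕ) : ℝ :=
  if j = 0 then -1 / 2 else ∑' k : ℕ, ((k : ℝ) ^ (2 * j))⁻¹

lemma sum_choose_mul_zetaEven (p K : ℕ) :
    ((K : ℝ) + 1) ^ (6 * p + 3) * (((K : ℝ) + 1) ^ (2 * p + 1))⁻¹ *
      ∑ k ∈ range (2 * p + 1), ((2 * p + k).choose (2 * p) : ℝ) *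
      (((K : ℝ) + 1) ^ (2 * p + 1 + k))⁻¹ *
      ((if Even (2 * p + 1 - k) then 2 * ∑' k' : ℕ, ((k' : ℝ) ^ (2 * p + 1 - k))⁻¹ else 0) -
        (((K : ℝ) + 1) ^ (2 * p + 1 - k))⁻¹) =
    2 * ∑ j ∈ range (p + 1), ((4 * p + 1 - 2 * j).choose (2 * p) : ℝ) * zetaEven j *
      ((K : ℝ) + 1) ^ (2 * j) := by
  set x : ℝ := (K : ℝ) + 1 with hx
  have hx0 : x ≠ 0 := by positivity
  have e : ∀ k ∈ range (2 * p + 1), x ^ (6 * p + 3) * (x ^ (2 * p + 1))⁻¹ *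
      (((2 * p + k).choose (2 * p) : ℝ) * (x ^ (2 * p + 1 + k))⁻¹ *
      ((if Even (2 * p + 1 - k) then 2 * ∑' k' : ℕ, ((k' : ℝ) ^ (2 * p + 1 - k))⁻¹ else 0) -
        (x ^ (2 * p + 1 - k))⁻¹)) =
      (if Even (2 * p + 1 - k) then 2 * ((2 * p + k).choose (2 * p) : ℝ) *
        (∑' k' : ℕ, ((k' : ℝ) ^ (2 * p + 1 - k))⁻¹) * x ^ (2 * p + 1 - k) else 0) -
        ((k + 2 * p).choose (2 * p) : ℝ) := by
    intro k hk
    obtain ⟨d, hd⟩ := Nat.exists_eq_add_of_le (Nat.lt_succ_iff.mp (mem_range.mp hk))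
    rw [show 2 * p + 1 - k = d + 1 by omega, show 6 * p + 3 =
      (2 * p + 1) + (2 * p + 1 + k) + (d + 1) by omega, pow_add, pow_add x (2 * p + 1),
      add_comm k (2 * p)]
    split_ifs <;> field_simp
    ring
  have ev : ∀ F : ℕ → ℝ,
      ∑ l ∈ range (p + 1), (if Even (2 * p + 1 - 2 * l) then F l else 0) = 0 := by
    refine fun F => sum_eq_zero fun l hl => if_neg ?_
    have := mem_range.1 hl
    rw [Nat.not_even_iff_odd]
    exact ⟨p - l, by omega⟩
  rw [mul_sum, sum_congr rfl e, sum_sub_distrib, sum_range_two_mul_add_one, ← Nat.cast_sum,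
    Nat.sum_range_add_choose, ← sum_range_reflect _ p, ev, zero_add, sum_range_succ' _ p, mul_add,
    mul_sum, sub_eq_add_neg]
  congr 1
  · refine sum_congr rfl fun j hj => ?_
    have := mem_range.1 hj
    rw [show 2 * p + 1 - (2 * (p - 1 - j) + 1) = 2 * (j + 1) by omega,
      if_pos (even_two_mul _), show 2 * p + (2 * (p - 1 - j) + 1) = 4 * p + 1 - 2 * (j + 1) by omega,
      zetaEven, if_neg (Nat.succ_ne_zero j)]
    ring
  · rw [zetaEven, if_pos rfl, mul_zero, Nat.sub_zero, pow_zero,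
      show 4 * p + 1 = 2 * p + (2 * p + 1) by ring, Nat.choose_symm_add,
      show 2 * p + (2 * p + 1) = 2 * p + 2 * p + 1 by ring]
    ring

/-- Closed form of the weighted difference between convolution and correlation. -/
lemma inv_pow_mul_convolution_sub_correlation {p : ℕ} (hp : p ≠ 0) (N : ℕ) :
    ((N : ℝ) ^ (2 * p + 1))⁻¹ * (∑ a ∈ antidiagonal N, (((a.1 : ℝ) * a.2) ^ (2 * p + 1))⁻¹ -
      2 * ∑' k : ℕ, (((k : ℝ) * (N + k)) ^ (2 * p + 1))⁻¹) =
    4 * ∑ j ∈ range (p + 1), ((4 * p + 1 - 2 * j).choose (2 * p) : ℝ) * zetaEven j *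
      ((N : ℝ) ^ (6 * p + 3 - 2 * j))⁻¹ := by
  rcases N with _ | K
  · rw [sum_eq_zero (s := range (p + 1))]
    · simp
    · intro j hj
      have := mem_range.1 hj
      rw [Nat.cast_zero, zero_pow (by omega), inv_zero, mul_zero]
  · have ha : ∑ a ∈ antidiagonal (K + 1), (((a.1 : ℝ) * a.2) ^ (2 * p + 1))⁻¹ =
        ∑ m ∈ range K, ((((m : ℝ) + 1) * (K - m)) ^ (2 * p + 1))⁻¹ := by
      rw [Finset.Nat.sum_antidiagonal_eq_sum_range_succ_mk, sum_range_succ, sum_range_succ']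
      simp only [Nat.cast_zero, zero_mul, Nat.sub_self, mul_zero,
        zero_pow (Nat.succ_ne_zero (2 * p)), inv_zero, add_zero]
      refine sum_congr rfl fun m hm => ?_
      have := mem_range.1 hm
      rw [Nat.add_sub_add_right, Nat.cast_sub this.le]
      push_cast
      rfl
    rw [ha, convolution_sub_two_mul_correlation (even_two_mul p) (by omega)]
    have h := sum_choose_mul_zetaEven p K
    have hx0 : ((K : ℝ) + 1) ≠ 0 := by positivity
    have e : ∑ j ∈ range (p + 1), ((4 * p + 1 - 2 * j).choose (2 * p) : ℝ) * zetaEven j *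
        (((K + 1 : ℕ) : ℝ) ^ (6 * p + 3 - 2 * j))⁻¹ = (((K : ℝ) + 1) ^ (6 * p + 3))⁻¹ *
        ∑ j ∈ range (p + 1), ((4 * p + 1 - 2 * j).choose (2 * p) : ℝ) * zetaEven j *
          ((K : ℝ) + 1) ^ (2 * j) := by
      rw [mul_sum]
      refine sum_congr rfl fun j hj => ?_
      have := mem_range.1 hj
      obtain ⟨d, hd⟩ := Nat.exists_eq_add_of_le (show 2 * j ≤ 6 * p + 3 by omega)
      rw [hd, Nat.add_sub_cancel_left, pow_add]
      push_cast
      field_simp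
    rw [e]
    rw [mul_assoc, mul_comm, ← eq_div_iff (by positivity)] at h
    rw [Nat.cast_add_one, mul_left_comm, h]
    ring

/-- The terms of the Tornheim double series, with junk value `0` if an index vanishes. -/
noncomputable def tornheimTerm (r : ℕ) (a : ℕ × ℕ) : ℝ :=
  (((a.1 : ℝ) * a.2 * (a.1 + a.2)) ^ r)⁻¹

lemma summable_mul_tornheimTerm {r : ℕ} (hr : 1 < r) {ε : ℕ × ℕ → ℝ} {C : ℝ} (hε : ∀ a, |ε a| ≤ C) :
    Summable fun a => ε a * tornheimTerm r a := by
  have hC : 0 ≤ C := (abs_nonneg _).trans (hε 0)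
  have hs := Real.summable_nat_pow_inv.2 hr
  refine Summable.of_norm_bounded ((hs.mul_of_nonneg hs (fun _ => by positivity)
    (fun _ => by positivity)).mul_left C) fun a => ?_
  rw [norm_mul, Real.norm_eq_abs]
  refine mul_le_mul (hε a) ?_ (norm_nonneg _) hC
  obtain ⟨m, n⟩ := a
  rw [tornheimTerm, Real.norm_of_nonneg (by positivity), ← mul_inv, ← mul_pow]
  rcases Nat.eq_zero_or_pos m with rfl | hm
  · simp [show r ≠ 0 by omega]
  rcases Nat.eq_zero_or_pos n with rfl | hn
  · simp [show r ≠ 0 by omega]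
  have hm' : (1 : ℝ) ≤ m := by exact_mod_cast hm
  have hn' : (1 : ℝ) ≤ n := by exact_mod_cast hn
  refine inv_anti₀ (by positivity) (pow_le_pow_left₀ (by positivity) ?_ r)
  exact le_mul_of_one_le_right (by positivity) (by linarith)

lemma tsum_antidiagonal_sub_two_mul_tsum {r : ℕ} (hr : 1 < r) {ε : ℕ → ℝ} (hε : ∀ n, |ε n| ≤ 1) :
    ∑' a : ℕ × ℕ, ε (a.1 + a.2) * tornheimTerm r a - 2 * ∑' a : ℕ × ℕ, ε a.1 * tornheimTerm r a =
    ∑' N : ℕ, ε N * (((N : ℝ) ^ r)⁻¹ * (∑ a ∈ antidiagonal N, (((a.1 : ℝ) * a.2) ^ r)⁻¹ -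
      2 * ∑' k : ℕ, (((k : ℝ) * (N + k)) ^ r)⁻¹)) := by
  have h1 := summable_mul_tornheimTerm hr (ε := fun a => ε (a.1 + a.2)) fun a => hε _
  have h2 := summable_mul_tornheimTerm hr (ε := fun a => ε a.1) fun a => hε _
  have e1 : ∀ N : ℕ, ∑ a ∈ antidiagonal N, ε (a.1 + a.2) * tornheimTerm r a =
      ε N * (((N : ℝ) ^ r)⁻¹ * ∑ a ∈ antidiagonal N, (((a.1 : ℝ) * a.2) ^ r)⁻¹) := by
    intro N
    rw [mul_sum, mul_sum]
    refine sum_congr rfl fun a ha => ?_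
    rw [mem_antidiagonal.1 ha, tornheimTerm, ← Nat.cast_add, mem_antidiagonal.1 ha, mul_pow _ (N : ℝ),
      mul_inv, mul_comm (((N : ℝ) ^ r)⁻¹)]
  have e2 : ∀ N : ℕ, ∑' k : ℕ, ε N * tornheimTerm r (N, k) =
      ε N * (((N : ℝ) ^ r)⁻¹ * ∑' k : ℕ, (((k : ℝ) * (N + k)) ^ r)⁻¹) := by
    intro N
    rw [← tsum_mul_left, ← tsum_mul_left]
    refine tsum_congr fun k => ?_
    rw [tornheimTerm, mul_assoc, mul_pow, mul_inv]
  have s1 := (HasAntidiagonal.sigmaAntidiagonalEquivProd :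
    (Σ n : ℕ, antidiagonal n) ≃ ℕ × ℕ).summable_iff.2 h1
  have t1 := ((HasAntidiagonal.sigmaAntidiagonalEquivProd :
    (Σ n : ℕ, antidiagonal n) ≃ ℕ × ℕ).tsum_eq fun a : ℕ × ℕ =>
      ε (a.1 + a.2) * tornheimTerm r a).symm.trans s1.tsum_sigma
  have s1' := s1.sigma
  have f1 : ∀ N : ℕ, ∑' c : antidiagonal N, ((fun a : ℕ × ℕ => ε (a.1 + a.2) * tornheimTerm r a) ∘
      HasAntidiagonal.sigmaAntidiagonalEquivProd) ⟨N, c⟩ =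
      ε N * (((N : ℝ) ^ r)⁻¹ * ∑ a ∈ antidiagonal N, (((a.1 : ℝ) * a.2) ^ r)⁻¹) := by
    intro N
    rw [← e1, ← Finset.tsum_subtype]
    rfl
  simp only [f1] at s1'
  have s2' := h2.prod
  have t2 := h2.tsum_prod
  simp only [e2] at s2' t2
  rw [t2, t1, tsum_congr f1, ← tsum_mul_left, ← s1'.tsum_sub (s2'.mul_left 2)]
  exact tsum_congr fun N => by ring

/-- Restricting the Tornheim series to even indices rescales it. -/
lemma tsum_even_tornheimTerm {r : ℕ} :
    ∑' a : ℕ × ℕ, ((1 + (-1 : ℝ) ^ a.1) * (1 + (-1) ^ a.2)) * tornheimTerm r a =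
      4 * (2 ^ (3 * r))⁻¹ * ∑' a : ℕ × ℕ, tornheimTerm r a := by
  have hinj : Function.Injective fun a : ℕ × ℕ => (2 * a.1, 2 * a.2) := by
    rintro ⟨a, b⟩ ⟨c, d⟩ h
    simpa using h
  rw [← tsum_mul_left, ← hinj.tsum_eq]
  · refine tsum_congr fun a => ?_
    have : tornheimTerm r (2 * a.1, 2 * a.2) = (2 ^ (3 * r))⁻¹ * tornheimTerm r a := by
      rw [tornheimTerm, tornheimTerm, pow_mul, ← mul_inv, ← mul_pow]
      push_cast
      congr 2
      ring
    simp only [this, pow_mul, neg_one_sq, one_pow]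
    ring
  · rintro ⟨m, n⟩ h
    rw [Function.mem_support] at h
    rcases Nat.even_or_odd' m with ⟨a, rfl | rfl⟩
    · rcases Nat.even_or_odd' n with ⟨b, rfl | rfl⟩
      · exact ⟨(a, b), rfl⟩
      · simp [pow_add, pow_mul] at h
    · simp [pow_add, pow_mul] at h

lemma tsum_even_inv_pow (s : ℕ) :
    ∑' n : ℕ, (1 + (-1 : ℝ) ^ n) * ((n : ℝ) ^ s)⁻¹ =
      2 * (2 ^ s)⁻¹ * ∑' n : ℕ, ((n : ℝ) ^ s)⁻¹ := by
  have hinj : Function.Injective fun a : ℕ => 2 * a := mul_right_injective₀ two_ne_zero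
  rw [← tsum_mul_left, ← hinj.tsum_eq]
  · refine tsum_congr fun a => ?_
    simp only [pow_mul, neg_one_sq, one_pow]
    push_cast
    rw [mul_pow, mul_inv]
    ring
  · intro n h
    rw [Function.mem_support] at h
    rcases Nat.even_or_odd' n with ⟨a, rfl | rfl⟩
    · exact ⟨a, rfl⟩
    · simp [pow_add, pow_mul] at h

lemma tornheimTerm_swap (r : ℕ) (a : ℕ × ℕ) : tornheimTerm r a.swap = tornheimTerm r a := by
  simp only [tornheimTerm, Prod.fst_swap, Prod.snd_swap]
  congr 2
  ring

/-- Evaluation of the symmetric alternating Tornheim series in terms of real zeta values. -/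
lemma tsum_alternating_tornheimTerm {p : ℕ} (hp : p ≠ 0) :
    ∑' a : ℕ × ℕ, (-1 : ℝ) ^ (a.1 + a.2) * tornheimTerm (2 * p + 1) a =
      (2 ^ (6 * p) : ℝ)⁻¹ * ∑ j ∈ range (p + 1), ((4 * p + 1 - 2 * j).choose (2 * p) : ℝ) *
        (2 ^ (2 * j) / 2 - 1) * zetaEven j * ∑' n : ℕ, ((n : ℝ) ^ (6 * p + 3 - 2 * j))⁻¹ := by
  have hr : 1 < 2 * p + 1 := by omega
  have hT := tsum_antidiagonal_sub_two_mul_tsum hr (ε := fun _ => 1) (by simp)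
  have hS := tsum_antidiagonal_sub_two_mul_tsum hr (ε := fun n => (-1) ^ n) (by simp)
  simp only [inv_pow_mul_convolution_sub_correlation hp, one_mul] at hT hS
  have hE := tsum_even_tornheimTerm (r := 2 * p + 1)
  have h0 := summable_mul_tornheimTerm hr (ε := fun _ => 1) (C := 1) (by simp)
  have h1 := summable_mul_tornheimTerm hr (ε := fun a => (-1) ^ a.1) (C := 1) (by simp)
  have h2 := summable_mul_tornheimTerm hr (ε := fun a => (-1) ^ a.2) (C := 1) (by simp)
  have h3 := summable_mul_tornheimTerm hr (ε := fun a => (-1) ^ (a.1 + a.2)) (C := 1) (by simp)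
  have h12 : ∑' a : ℕ × ℕ, (-1 : ℝ) ^ a.2 * tornheimTerm (2 * p + 1) a =
      ∑' a : ℕ × ℕ, (-1 : ℝ) ^ a.1 * tornheimTerm (2 * p + 1) a := by
    rw [← (Equiv.prodComm ℕ ℕ).tsum_eq]
    exact tsum_congr fun a => by
      rw [Equiv.prodComm_apply, tornheimTerm_swap, Prod.snd_swap]
  have hsplit : ∑' a : ℕ × ℕ, ((1 + (-1 : ℝ) ^ a.1) * (1 + (-1) ^ a.2)) *
      tornheimTerm (2 * p + 1) a = ∑' a : ℕ × ℕ, tornheimTerm (2 * p + 1) a +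
      2 * ∑' a : ℕ × ℕ, (-1 : ℝ) ^ a.1 * tornheimTerm (2 * p + 1) a +
      ∑' a : ℕ × ℕ, (-1 : ℝ) ^ (a.1 + a.2) * tornheimTerm (2 * p + 1) a := by
    have := ((h0.add h1).add h2).tsum_add h3
    rw [(h0.add h1).tsum_add h2, h0.tsum_add h1, h12] at this
    simp only [one_mul] at this
    rw [two_mul (∑' a : ℕ × ℕ, (-1 : ℝ) ^ a.1 * tornheimTerm (2 * p + 1) a), ← add_assoc, ← this]
    exact tsum_congr fun a => by ring
  rw [hsplit] at hE
  have hsum : ∀ {ε : ℕ → ℝ}, (∀ n, |ε n| ≤ 1) → ∀ j ∈ range (p + 1), Summable fun N : ℕ =>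
      ε N * (((4 * p + 1 - 2 * j).choose (2 * p) : ℝ) * zetaEven j *
        ((N : ℝ) ^ (6 * p + 3 - 2 * j))⁻¹) := by
    intro ε hε j hj
    have := mem_range.1 hj
    refine Summable.of_norm_bounded
      ((Real.summable_nat_pow_inv.2 (show 1 < 6 * p + 3 - 2 * j by omega)).mul_left
        ‖((4 * p + 1 - 2 * j).choose (2 * p) : ℝ) * zetaEven j‖) fun N => ?_
    rw [norm_mul, norm_mul _ (((N : ℝ) ^ (6 * p + 3 - 2 * j))⁻¹), Real.norm_eq_abs (ε N),
      Real.norm_of_nonneg (show 0 ≤ ((N : ℝ) ^ (6 * p + 3 - 2 * j))⁻¹ by positivity)]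
    exact mul_le_of_le_one_left (by positivity) (hε N)
  have hexp : ∀ {ε : ℕ → ℝ}, (∀ n, |ε n| ≤ 1) → ∑' N : ℕ, ε N * (4 * ∑ j ∈ range (p + 1),
      ((4 * p + 1 - 2 * j).choose (2 * p) : ℝ) * zetaEven j * ((N : ℝ) ^ (6 * p + 3 - 2 * j))⁻¹) =
      4 * ∑ j ∈ range (p + 1), ((4 * p + 1 - 2 * j).choose (2 * p) : ℝ) * zetaEven j *
        ∑' N : ℕ, ε N * ((N : ℝ) ^ (6 * p + 3 - 2 * j))⁻¹ := by
    intro ε hε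
    simp only [mul_left_comm _ (4 : ℝ), mul_sum (range (p + 1)) _ (_ : ℝ)]
    rw [Summable.tsum_finsetSum fun j hj => (hsum hε j hj).mul_left 4]
    refine sum_congr rfl fun j _ => ?_
    rw [tsum_mul_left]
    congr 1
    rw [← tsum_mul_left]
    exact tsum_congr fun N => by ring
  have hT' := hexp (ε := fun _ => 1) (by simp)
  have hS' := hexp (ε := fun n => (-1) ^ n) (by simp)
  simp only [one_mul] at hT'
  rw [hT'] at hT
  rw [hS'] at hS
  have hz : ∀ j ∈ range (p + 1), ∑' n : ℕ, (-1 : ℝ) ^ n * ((n : ℝ) ^ (6 * p + 3 - 2 * j))⁻¹ =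
      (2 * (2 ^ (6 * p + 3 - 2 * j))⁻¹ - 1) * ∑' n : ℕ, ((n : ℝ) ^ (6 * p + 3 - 2 * j))⁻¹ := by
    intro j hj
    have := mem_range.1 hj
    have hs := Real.summable_nat_pow_inv.2 (show 1 < 6 * p + 3 - 2 * j by omega)
    have hs' : Summable fun n : ℕ => (-1 : ℝ) ^ n * ((n : ℝ) ^ (6 * p + 3 - 2 * j))⁻¹ :=
      Summable.of_norm_bounded hs fun n => by simp
    have h := tsum_even_inv_pow (6 * p + 3 - 2 * j)
    simp only [add_mul, one_mul] at h
    rw [hs.tsum_add hs'] at h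
    linarith
  rw [sum_congr rfl fun j hj => by rw [hz j hj]] at hS
  set T := ∑' a : ℕ × ℕ, tornheimTerm (2 * p + 1) a
  set S := ∑' a : ℕ × ℕ, (-1 : ℝ) ^ (a.1 + a.2) * tornheimTerm (2 * p + 1) a
  have hfin : S = 2⁻¹ * (4 * ∑ j ∈ range (p + 1), ((4 * p + 1 - 2 * j).choose (2 * p) : ℝ) *
      zetaEven j * ((2 * (2 ^ (6 * p + 3 - 2 * j))⁻¹ - 1) *
        ∑' n : ℕ, ((n : ℝ) ^ (6 * p + 3 - 2 * j))⁻¹) +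
      (1 - 4 * (2 ^ (3 * (2 * p + 1)))⁻¹) * (4 * ∑ j ∈ range (p + 1),
        ((4 * p + 1 - 2 * j).choose (2 * p) : ℝ) * zetaEven j *
        ∑' n : ℕ, ((n : ℝ) ^ (6 * p + 3 - 2 * j))⁻¹)) := by
    rw [← hT, ← hS]
    linear_combination (1 / 2) * hE
  rw [hfin]
  simp only [mul_sum]
  rw [← sum_add_distrib, mul_sum]
  refine sum_congr rfl fun j hj => ?_
  have := mem_range.1 hj
  obtain ⟨d, hd⟩ := Nat.exists_eq_add_of_le (show 2 * j ≤ 6 * p by omega)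
  rw [show 6 * p + 3 - 2 * j = d + 3 by omega, show 3 * (2 * p + 1) = 2 * j + d + 3 by omega, hd]
  simp only [pow_add]
  field_simp
  ring

lemma riemannZeta_two_mul_natCast (j : ℕ) : riemannZeta (2 * j) = (zetaEven j : ℂ) := by
  rcases Nat.eq_zero_or_pos j with rfl | hj
  · rw [zetaEven, if_pos rfl, Nat.cast_zero, mul_zero, riemannZeta_zero]
    push_cast
    ring
  · rw [zetaEven, if_neg hj.ne', ← Nat.cast_ofNat, ← Nat.cast_mul,
      zeta_nat_eq_tsum_of_gt_one (by omega)]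
    push_cast
    simp only [one_div]

lemma tornheimS_natCast {r : ℕ} (hr : 1 < r) :
    tornheimS r r r = ∑' a : ℕ × ℕ, (-1 : ℝ) ^ (a.1 + a.2) * tornheimTerm r a := by
  have h := summable_mul_tornheimTerm hr (ε := fun a => (-1) ^ (a.1 + a.2)) (C := 1) (by simp)
  rw [h.tsum_prod, h.prod.tsum_eq_zero_add, tornheimS]
  have h0 : ∑' n : ℕ, (-1 : ℝ) ^ (0 + n) * tornheimTerm r (0, n) = 0 := by
    simp [tornheimTerm, show r ≠ 0 by omega]
  rw [h0, zero_add]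
  refine tsum_congr fun m => ?_
  rw [(h.prod_factor (m + 1)).tsum_eq_zero_add]
  have h1 : (-1 : ℝ) ^ (m + 1 + 0) * tornheimTerm r (m + 1, 0) = 0 := by
    simp [tornheimTerm, show r ≠ 0 by omega]
  rw [h1, zero_add]
  refine tsum_congr fun n => ?_
  simp only [Real.rpow_natCast, tornheimTerm]
  rw [← mul_pow, ← mul_pow, div_eq_mul_inv]
  push_cast
  congr 4
  ring

theorem eval_S_odd_diag (p : ℕ) (hp : 1 ≤ p) :
    (tornheimS (2 * p + 1) (2 * p + 1) (2 * p + 1) : ℂ) =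
      (2 : ℂ) ^ (-(6 * p : ℤ)) * ∑ j ∈ Finset.range (p + 1),
        ((4 * p + 1 - 2 * j).choose (2 * p) : ℂ) *
          ((2 : ℂ) ^ ((2 * j : ℤ) - 1) - 1) * riemannZeta (2 * j) *
          riemannZeta ((6 * p + 3 - 2 * j : ℕ)) := by
  have h := tornheimS_natCast (show 1 < 2 * p + 1 by omega)
  rw [tsum_alternating_tornheimTerm (by omega)] at h
  push_cast at h
  rw [h]
  push_cast
  congr 1
  · rw [zpow_neg]
    norm_cast
  · refine sum_congr rfl fun j hj => ?_
    have := mem_range.1 hj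
    rw [riemannZeta_two_mul_natCast, zeta_nat_eq_tsum_of_gt_one (by omega),
      zpow_sub₀ two_ne_zero, zpow_one]
    simp only [one_div]
    norm_cast
end
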